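/- arXiv:1211.0812 — 2 statements merged into one kernel-verified Lean document; each statement's English description precedes it below -/
import Mathlib

section
/- Let S and T be positive bounded linear operators on a Banach lattice E such that S ≤ T (i.e., T − S is positive) and the spectral radii of S and T are equal. If T is an ideal-irreducible power-compact operator, then S = T. -/
open Filter Topology

set_option linter.unusedSectionVars false

/-- Approximate eigenvectors of `A` are approximate eigenvectors of the powers of `A`. -/
theorem pow_apply_sub_tendsto {ι G : Type*} [NormedAddCommGroup G] [NormedSpace ℝ G]
    {l : Filter ι} {A : G →L[ℝ] G} {r : ℝ} {x : ι → G}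
    (h : Tendsto (fun k => A (x k) - r • x k) l (𝓝 0)) (m : ℕ) :
    Tendsto (fun k => (A ^ m) (x k) - r ^ m • x k) l (𝓝 0) := by
  induction m with
  | zero => simpa using tendsto_const_nhds
  | succ m ih =>
    have := ((A.continuous.tendsto 0).comp ih).add (h.const_smul (r ^ m))
    simp only [map_zero, smul_zero, add_zero] at this
    refine this.congr fun k => ?_
    simp only [map_sub, map_smul, pow_succ' A, mul_apply_eq_comp, Function.comp_apply,
      pow_succ r]
    module

section BanachLattice

variable {E : Type*} [NormedAddCommGroup E] [Lattice E] [HasSolidNorm E]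
  [IsOrderedAddMonoid E] [NormedSpace ℝ E]
variable {F : Type*} [NormedAddCommGroup F] [Lattice F] [HasSolidNorm F]
  [IsOrderedAddMonoid F] [NormedSpace ℝ F]

theorem real_smul_nonneg {c : ℝ} (hc : 0 ≤ c) {x : E} (hx : 0 ≤ x) : 0 ≤ c • x := by
  have half : ∀ y : E, 0 ≤ y → 0 ≤ (1 / 2 : ℝ) • y := fun y hy => by
    apply nsmul_two_semiclosed
    rw [← Nat.cast_smul_eq_nsmul ℝ, smul_smul]
    norm_num
    exact hy
  have dyadic : ∀ m : ℕ, 0 ≤ ((1 / 2 : ℝ) ^ m) • x := fun m => by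
    induction m with
    | zero => simpa using hx
    | succ m ih => rw [pow_succ', mul_smul]; exact half _ ih
  have hlim : Tendsto (fun m : ℕ => (⌊c * (2 : ℝ) ^ m⌋₊ / (2 : ℝ) ^ m : ℝ) • x) atTop
      (𝓝 (c • x)) :=
    ((tendsto_nat_floor_mul_div_atTop hc).comp
      (tendsto_pow_atTop_atTop_of_one_lt one_lt_two)).smul_const x
  refine ge_of_tendsto' hlim fun m => ?_
  have := nsmul_nonneg (dyadic m) ⌊c * (2 : ℝ) ^ m⌋₊
  rwa [← Nat.cast_smul_eq_nsmul ℝ, smul_smul, one_div, inv_pow, ← div_eq_mul_inv] at this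

theorem real_smul_le_smul {c : ℝ} (hc : 0 ≤ c) {x y : E} (h : x ≤ y) : c • x ≤ c • y := by
  rw [← sub_nonneg, ← smul_sub]
  exact real_smul_nonneg hc (sub_nonneg.2 h)

theorem abs_real_smul_le (c : ℝ) (x : E) : |c • x| ≤ |c| • |x| := by
  have key : ∀ d : ℝ, 0 ≤ d → |d • x| ≤ d • |x| := fun d hd => by
    refine abs_le'.2 ⟨real_smul_le_smul hd (le_abs_self x), ?_⟩
    rw [← smul_neg]
    exact real_smul_le_smul hd (neg_le_abs x)
  rcases le_total 0 c with hc | hc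
  · rw [abs_of_nonneg hc]; exact key c hc
  · rw [abs_of_nonpos hc, ← abs_neg, ← neg_smul]
    exact key _ (neg_nonneg.2 hc)

/-- A continuous linear map between normed lattices is order positive if it maps the positive
cone into the positive cone. -/
def OrderPositive (A : E →L[ℝ] F) : Prop :=
  ∀ x, 0 ≤ x → 0 ≤ A x

theorem norm_le_of_nonneg_of_le {x y : E} (hx : 0 ≤ x) (h : x ≤ y) : ‖x‖ ≤ ‖y‖ :=
  norm_le_norm_of_abs_le_abs (by rwa [abs_of_nonneg hx, abs_of_nonneg (hx.trans h)])

theorem eq_zero_of_abs_eq_zero {x : E} (h : |x| = 0) : x = 0 := by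
  rw [← norm_eq_zero, ← norm_abs_eq_norm, h, norm_zero]

namespace OrderPositive

theorem mono {A : E →L[ℝ] F} (hA : OrderPositive A) {x y : E} (h : x ≤ y) : A x ≤ A y := by
  rw [← sub_nonneg, ← map_sub]
  exact hA _ (sub_nonneg.2 h)

theorem abs_apply_le {A : E →L[ℝ] F} (hA : OrderPositive A) (x : E) : |A x| ≤ A |x| := by
  refine abs_le'.2 ⟨hA.mono (le_abs_self x), ?_⟩
  rw [← map_neg]
  exact hA.mono (neg_le_abs x)

theorem norm_apply_le {A : E →L[ℝ] F} (hA : OrderPositive A) (x : E) : ‖A x‖ ≤ ‖A |x|‖ := by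
  rw [← norm_abs_eq_norm]
  exact norm_le_of_nonneg_of_le (abs_nonneg _) (hA.abs_apply_le x)

theorem opNorm_le {A B : E →L[ℝ] F} (hA : OrderPositive A) (hAB : ∀ x, 0 ≤ x → A x ≤ B x) :
    ‖A‖ ≤ ‖B‖ := by
  refine A.opNorm_le_bound (norm_nonneg B) fun x => (hA.norm_apply_le x).trans ?_
  refine (norm_le_of_nonneg_of_le (hA _ (abs_nonneg x)) (hAB _ (abs_nonneg x))).trans ?_
  simpa only [norm_abs_eq_norm] using B.le_opNorm |x|

theorem mul {A B : E →L[ℝ] E} (hA : OrderPositive A) (hB : OrderPositive B) :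
    OrderPositive (A * B) := fun x hx => hA _ (hB x hx)

theorem one : OrderPositive (1 : E →L[ℝ] E) := fun _ hx => hx

theorem pow {A : E →L[ℝ] E} (hA : OrderPositive A) (n : ℕ) : OrderPositive (A ^ n) := by
  induction n with
  | zero => exact one
  | succ n ih => rw [pow_succ]; exact ih.mul hA

theorem smul {A : E →L[ℝ] F} (hA : OrderPositive A) {c : ℝ} (hc : 0 ≤ c) :
    OrderPositive (c • A) := fun x hx => real_smul_nonneg hc (hA x hx)

theorem sum {ι : Type*} {s : Finset ι} {A : ι → E →L[ℝ] F} (hA : ∀ i ∈ s, OrderPositive (A i)) :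
    OrderPositive (∑ i ∈ s, A i) := fun x hx => by
  rw [sum_apply]
  exact Finset.sum_nonneg fun i hi => hA i hi x hx

theorem pow_le_pow {S T : E →L[ℝ] E} (hS : OrderPositive S) (hT : OrderPositive T)
    (hST : ∀ x, 0 ≤ x → S x ≤ T x) (n : ℕ) {x : E} (hx : 0 ≤ x) : (S ^ n) x ≤ (T ^ n) x := by
  induction n with
  | zero => exact le_rfl
  | succ n ih =>
    rw [pow_succ', pow_succ']
    exact (hST _ (hS.pow n x hx)).trans (hT.mono ih)

/-- Positive operators of norm less than one have a positive Neumann resolvent. -/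
theorem exists_inverse_one_sub [CompleteSpace E] {B : E →L[ℝ] E} (hB : OrderPositive B)
    (h : ‖B‖ < 1) : ∃ P : E →L[ℝ] E, OrderPositive P ∧ (1 - B) * P = 1 ∧ P * (1 - B) = 1 := by
  refine ⟨∑' i : ℕ, B ^ i, fun x hx => ?_, mul_neg_geom_series B h, geom_series_mul_neg B h⟩
  have hs := (summable_geometric_of_norm_lt_one h).hasSum.mapL (ContinuousLinearMap.apply ℝ E x)
  exact hs.nonneg fun i => hB.pow i x hx

/-- If `A` is positive and some power of `A` has norm less than `μ ^ N`, then `μ - A` has a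
positive inverse. -/
theorem exists_resolvent [CompleteSpace E] {A : E →L[ℝ] E} (hA : OrderPositive A) {μ : ℝ}
    (hμ : 0 < μ) {N : ℕ} (h : ‖A ^ N‖ < μ ^ N) :
    ∃ P : E →L[ℝ] E, OrderPositive P ∧ (μ • 1 - A) * P = 1 ∧ P * (μ • 1 - A) = 1 := by
  have hB : OrderPositive (μ⁻¹ • A) := hA.smul (inv_nonneg.2 hμ.le)
  obtain ⟨Q, hQ, hQ1, hQ2⟩ := (hB.pow N).exists_inverse_one_sub (by
    rw [smul_pow, norm_smul, norm_pow, norm_inv, Real.norm_of_nonneg hμ.le, inv_pow,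
      inv_mul_lt_iff₀ (pow_pos hμ N)]
    simpa using h)
  set G := ∑ i ∈ Finset.range N, (μ⁻¹ • A) ^ i with hG
  have e : μ • (1 : E →L[ℝ] E) - A = μ • (1 - μ⁻¹ • A) := by
    rw [smul_sub, smul_smul, mul_inv_cancel₀ hμ.ne', one_smul]
  have hr : (μ • 1 - A) * (μ⁻¹ • (G * Q)) = 1 := by
    rw [e, smul_mul_smul_comm, mul_inv_cancel₀ hμ.ne', one_smul, ← mul_assoc, mul_neg_geom_sum, hQ1]
  have hl : (μ⁻¹ • (Q * G)) * (μ • 1 - A) = 1 := by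
    rw [e, smul_mul_smul_comm, inv_mul_cancel₀ hμ.ne', one_smul, mul_assoc, geom_sum_mul_neg, hQ2]
  refine ⟨μ⁻¹ • (G * Q), ((sum fun i _ => hB.pow i).mul hQ).smul (inv_nonneg.2 hμ.le), hr, ?_⟩
  rwa [left_inv_eq_right_inv hl hr] at hl

/-- If `μ - A` has a positive right inverse `P`, then `A ^ j ≤ μ ^ (j + 1) P`. -/
theorem norm_pow_le {A P : E →L[ℝ] E} (hA : OrderPositive A) (hP : OrderPositive P) {μ : ℝ}
    (hμ : 0 ≤ μ) (h : (μ • 1 - A) * P = 1) (j : ℕ) : ‖A ^ j‖ ≤ μ ^ (j + 1) * ‖P‖ := by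
  have hx : ∀ x, μ • P x = x + A (P x) := fun x => by
    have := congrArg (fun f : E →L[ℝ] E => f x) h
    simp at this
    rw [← sub_eq_iff_eq_add, this]
  have key : ∀ x, 0 ≤ x → (A ^ j) x ≤ (μ ^ (j + 1) • P) x := by
    induction j with
    | zero =>
      intro x h0
      simp only [pow_zero, zero_add, pow_one, smul_apply, hx]
      exact le_add_of_nonneg_right (hA _ (hP _ h0))
    | succ j ih =>
      intro x h0
      rw [pow_succ']
      refine (hA.mono (ih x h0)).trans ?_
      rw [smul_apply, smul_apply, map_smul,
        pow_succ μ (j + 1), mul_smul, hx]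
      exact real_smul_le_smul (pow_nonneg hμ _) (le_add_of_nonneg_left h0)
  refine ((hA.pow j).opNorm_le key).trans ?_
  rw [norm_smul, Real.norm_of_nonneg (pow_nonneg hμ _)]

theorem le_of_tendsto_root {u : ℕ → ℝ} (hu : ∀ n, 0 ≤ u n) {r μ C : ℝ} (hμ : 0 ≤ μ)
    (hr : Tendsto (fun n : ℕ => u n ^ (1 / (n : ℝ))) atTop (𝓝 r))
    (h : ∀ n, u n ≤ C * μ ^ n) : r ≤ μ := by
  have hC : 0 < |C| + 1 := by positivity
  have h0 : Tendsto (fun n : ℕ => 1 / (n : ℝ)) atTop (𝓝 0) := tendsto_one_div_atTop_nhds_zero_nat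
  have h1 : Tendsto (fun n : ℕ => (|C| + 1) ^ (1 / (n : ℝ)) * μ) atTop (𝓝 μ) := by
    simpa using ((tendsto_const_nhds (x := |C| + 1)).rpow h0 (Or.inl hC.ne')).mul_const μ
  refine le_of_tendsto_of_tendsto hr h1 ?_
  filter_upwards [eventually_ge_atTop 1] with n hn
  have hn0 : (n : ℝ) ≠ 0 := by positivity
  calc u n ^ (1 / (n : ℝ)) ≤ ((|C| + 1) * μ ^ n) ^ (1 / (n : ℝ)) := by
        refine Real.rpow_le_rpow (hu n) ((h n).trans ?_) (by positivity)
        exact mul_le_mul_of_nonneg_right (by linarith [le_abs_self C]) (by positivity)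
    _ = (|C| + 1) ^ (1 / (n : ℝ)) * μ := by
        rw [Real.mul_rpow hC.le (by positivity), ← Real.rpow_natCast μ n, ← Real.rpow_mul hμ,
          mul_one_div_cancel hn0, Real.rpow_one]

theorem eventually_lt_pow_of_tendsto_root {u : ℕ → ℝ} (hu : ∀ n, 0 ≤ u n) {r μ : ℝ}
    (hr : Tendsto (fun n : ℕ => u n ^ (1 / (n : ℝ))) atTop (𝓝 r)) (h : r < μ) :
    ∀ᶠ n in atTop, u n < μ ^ n := by
  filter_upwards [hr.eventually_lt_const h, eventually_ge_atTop 1] with n hn hn1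
  have hn0 : (n : ℝ) ≠ 0 := by positivity
  have := pow_lt_pow_left₀ hn (Real.rpow_nonneg (hu n) _) (by omega : n ≠ 0)
  rwa [← Real.rpow_natCast, ← Real.rpow_mul (hu n), one_div_mul_cancel hn0, Real.rpow_one] at this

/-- The resolvent of a positive operator blows up when approaching the spectral radius. -/
theorem exists_resolvent_norm_ge [CompleteSpace E] {A : E →L[ℝ] E} (hA : OrderPositive A) {r : ℝ}
    (hr : Tendsto (fun n : ℕ => ‖A ^ n‖ ^ (1 / (n : ℝ))) atTop (𝓝 r)) (hr0 : 0 < r) {δ : ℝ}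
    (hδ : 0 < δ) :
    ∃ P : E →L[ℝ] E, OrderPositive P ∧ ((r + δ) • 1 - A) * P = 1 ∧
      P * ((r + δ) • 1 - A) = 1 ∧ 1 ≤ δ * ‖P‖ := by
  obtain ⟨N, hN⟩ := (eventually_lt_pow_of_tendsto_root (fun n => norm_nonneg (A ^ n)) hr
    (lt_add_of_pos_right r hδ)).exists
  obtain ⟨P, hP, hP1, hP2⟩ := hA.exists_resolvent (by positivity) hN
  refine ⟨P, hP, hP1, hP2, ?_⟩
  by_contra! hlt
  obtain ⟨t, ht0, htr, htP⟩ : ∃ t : ℝ, 0 < t ∧ t < r ∧ (δ + t) * ‖P‖ < 1 := by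
    have hc : Tendsto (fun t : ℝ => (δ + t) * ‖P‖) (𝓝[>] 0) (𝓝 (δ * ‖P‖)) := by
      have : Continuous fun t : ℝ => (δ + t) * ‖P‖ := by fun_prop
      simpa using (this.tendsto 0).mono_left nhdsWithin_le_nhds
    obtain ⟨t, h1, h2⟩ := ((hc.eventually_lt_const hlt).and (Ioo_mem_nhdsGT hr0)).exists
    exact ⟨t, h2.1, h2.2, h1⟩
  obtain ⟨Q, hQ, hQ1, -⟩ := (hP.smul (by positivity : 0 ≤ δ + t)).exists_inverse_one_sub (by
    rwa [norm_smul, Real.norm_of_nonneg (by positivity)])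
  have hinv : ((r - t) • 1 - A) * (P * Q) = 1 := by
    have e : (r - t) • (1 : E →L[ℝ] E) - A = ((r + δ) • 1 - A) - (δ + t) • 1 := by
      rw [sub_right_comm, ← sub_smul]
      ring_nf
    rw [e, ← mul_assoc, sub_mul, hP1, smul_mul_assoc, one_mul, hQ1]
  have hle : r ≤ r - t := by
    refine le_of_tendsto_root (fun n => norm_nonneg (A ^ n)) (sub_nonneg.2 htr.le) hr
      (C := (r - t) * ‖P * Q‖) fun n => ?_
    refine (hA.norm_pow_le (hP.mul hQ) (sub_nonneg.2 htr.le) hinv n).trans_eq ?_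
    ring
  linarith

theorem exists_nonneg_half_norm_lt {P : E →L[ℝ] F} (hP : OrderPositive P) (hP0 : 0 < ‖P‖) :
    ∃ y : E, 0 ≤ y ∧ ‖y‖ ≤ 1 ∧ ‖P‖ / 2 < ‖P y‖ := by
  obtain ⟨y, hy, h⟩ := P.exists_lt_apply_of_lt_opNorm (half_lt_self hP0)
  exact ⟨|y|, abs_nonneg y, by rw [norm_abs_eq_norm]; exact hy.le, h.trans_le (hP.norm_apply_le y)⟩

/-- The spectral radius of a positive operator is an approximate eigenvalue with positive
approximate eigenvectors. -/
theorem exists_approx_eigenvector [CompleteSpace E] {A : E →L[ℝ] E} (hA : OrderPositive A) {r : ℝ}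
    (hr : Tendsto (fun n : ℕ => ‖A ^ n‖ ^ (1 / (n : ℝ))) atTop (𝓝 r)) (hr0 : 0 < r) {ε : ℝ}
    (hε : 0 < ε) : ∃ x : E, 0 ≤ x ∧ ‖x‖ = 1 ∧ ‖A x - r • x‖ ≤ ε := by
  obtain ⟨P, hP, hP1, -, hPn⟩ := hA.exists_resolvent_norm_ge hr hr0 (by positivity : 0 < ε / 3)
  obtain ⟨y, hy0, hy, hPy⟩ := hP.exists_nonneg_half_norm_lt (by
    by_contra! h
    nlinarith)
  set c := ‖P y‖ with hc
  have hc0 : 0 < c := by linarith [norm_nonneg P]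
  have hxP : A (P y) = (r + ε / 3) • P y - y := by
    have := congrArg (fun f : E →L[ℝ] E => f y) hP1
    simp at this
    rw [eq_sub_iff_add_eq, ← eq_sub_iff_add_eq', this]
  refine ⟨c⁻¹ • P y, real_smul_nonneg (inv_nonneg.2 hc0.le) (hP _ hy0), ?_, ?_⟩
  · rw [norm_smul, norm_inv, Real.norm_of_nonneg hc0.le, ← hc, inv_mul_cancel₀ hc0.ne']
  · have e : A (c⁻¹ • P y) - r • c⁻¹ • P y = c⁻¹ • ((ε / 3) • P y - y) := by
      rw [map_smul, hxP]
      module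
    rw [e, norm_smul, norm_inv, Real.norm_of_nonneg hc0.le, inv_mul_le_iff₀ hc0]
    refine (norm_sub_le _ _).trans ?_
    rw [norm_smul, Real.norm_of_nonneg (by positivity), ← hc]
    nlinarith

/-- Positive vectors are normed by positive functionals. -/
theorem _root_.exists_orderPositive_apply_eq_norm {x : E} (hx : 0 ≤ x) :
    ∃ φ : E →L[ℝ] ℝ, OrderPositive φ ∧ ‖φ‖ ≤ 1 ∧ φ x = ‖x‖ := by
  rcases eq_or_ne x 0 with rfl | hx0
  · exact ⟨0, fun _ _ => le_rfl, by simp, by simp⟩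
  have hpos : ∀ c : ℝ, 0 ≤ c → ∀ y : E, (c • y)⁺ = c • y⁺ := fun c hc y => by
    rcases hc.eq_or_lt with rfl | hc
    · simp
    refine le_antisymm (sup_le (real_smul_le_smul hc.le (le_posPart y))
      (real_smul_nonneg hc.le (posPart_nonneg y))) ?_
    have : y⁺ ≤ c⁻¹ • (c • y)⁺ := by
      refine sup_le ?_ (real_smul_nonneg (inv_nonneg.2 hc.le) (posPart_nonneg _))
      have := real_smul_le_smul (inv_nonneg.2 hc.le) (le_posPart (c • y))
      rwa [smul_smul, inv_mul_cancel₀ hc.ne', one_smul] at this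
    have := real_smul_le_smul hc.le this
    rwa [smul_smul, mul_inv_cancel₀ hc.ne', one_smul] at this
  obtain ⟨g, hg, hgN⟩ := exists_extension_of_le_sublinear
    (LinearPMap.mkSpanSingleton x ‖x‖ hx0) (fun y => ‖y⁺‖)
    (fun c hc y => by simp only [hpos c hc.le y, norm_smul, Real.norm_of_nonneg hc.le])
    (fun y z => by
      refine (norm_le_of_nonneg_of_le (posPart_nonneg _) ?_).trans (norm_add_le _ _)
      exact sup_le (add_le_add (le_posPart y) (le_posPart z))
        (add_nonneg (posPart_nonneg y) (posPart_nonneg z)))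
    (by
      rintro ⟨y, hy⟩
      obtain ⟨c, rfl⟩ := Submodule.mem_span_singleton.1 hy
      rw [LinearPMap.mkSpanSingleton'_apply]
      simp only [RingHom.id_apply, smul_eq_mul]
      rcases le_total 0 c with hc | hc
      · rw [hpos c hc, posPart_of_nonneg hx, norm_smul, Real.norm_of_nonneg hc]
      · exact (mul_nonpos_of_nonpos_of_nonneg hc (norm_nonneg x)).trans (norm_nonneg _))
  have hle : ∀ y, g y ≤ ‖y‖ := fun y => by
    refine (hgN y).trans ?_
    rw [← norm_abs_eq_norm y]
    exact norm_le_of_nonneg_of_le (posPart_nonneg y) (sup_le (le_abs_self y) (abs_nonneg y))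
  refine ⟨g.mkContinuous 1 fun y => ?_, fun y hy => ?_, g.mkContinuous_norm_le zero_le_one _, ?_⟩
  · rw [one_mul, Real.norm_eq_abs, abs_le']
    exact ⟨hle y, by simpa using hle (-y)⟩
  · have := hgN (-y)
    rw [posPart_eq_zero.2 (neg_nonpos.2 hy)] at this
    simpa using this
  · have := hg ⟨x, Submodule.mem_span_singleton_self x⟩
    rw [LinearPMap.mkSpanSingleton_apply] at this
    exact this

/-- The adjoint of a positive operator has the spectral radius as an approximate eigenvalue, with
positive approximate eigenvectors. -/
theorem exists_approx_eigenfunctional [CompleteSpace E] {A : E →L[ℝ] E} (hA : OrderPositive A)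
    {r : ℝ} (hr : Tendsto (fun n : ℕ => ‖A ^ n‖ ^ (1 / (n : ℝ))) atTop (𝓝 r)) (hr0 : 0 < r)
    {ε : ℝ} (hε : 0 < ε) :
    ∃ φ : E →L[ℝ] ℝ, OrderPositive φ ∧ ‖φ‖ = 1 ∧ ‖φ ∘L A - r • φ‖ ≤ ε := by
  obtain ⟨P, hP, -, hP1, hPn⟩ := hA.exists_resolvent_norm_ge hr hr0 (by positivity : 0 < ε / 3)
  obtain ⟨y, hy0, hy, hPy⟩ := hP.exists_nonneg_half_norm_lt (by
    by_contra! h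
    nlinarith)
  obtain ⟨ψ, hψ, hψ1, hψy⟩ := exists_orderPositive_apply_eq_norm (hP y hy0)
  set c := ‖ψ ∘L P‖ with hc
  have hyc : ‖P y‖ ≤ c := by
    rw [← hψy, hc]
    exact (le_abs_self _).trans (((ψ ∘L P).le_opNorm y).trans
      (mul_le_of_le_one_right (norm_nonneg _) hy))
  have hc0 : 0 < c := by linarith [norm_nonneg P]
  have hPA : (ψ ∘L P) ∘L A = (r + ε / 3) • (ψ ∘L P) - ψ := by
    ext x
    have := congrArg (fun f : E →L[ℝ] E => ψ (f x)) hP1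
    simp at this
    simp
    linarith
  refine ⟨c⁻¹ • (ψ ∘L P), fun x hx => ?_, ?_, ?_⟩
  · exact mul_nonneg (inv_nonneg.2 hc0.le) (hψ _ (hP x hx))
  · rw [norm_smul, norm_inv, Real.norm_of_nonneg hc0.le, ← hc, inv_mul_cancel₀ hc0.ne']
  · have e : (c⁻¹ • (ψ ∘L P)) ∘L A - r • c⁻¹ • (ψ ∘L P) = c⁻¹ • ((ε / 3) • (ψ ∘L P) - ψ) := by
      rw [ContinuousLinearMap.smul_comp, hPA]
      module
    rw [e, norm_smul, norm_inv, Real.norm_of_nonneg hc0.le, inv_mul_le_iff₀ hc0]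
    refine (norm_sub_le _ _).trans ?_
    rw [norm_smul, Real.norm_of_nonneg (by positivity), ← hc]
    nlinarith


theorem _root_.IsCompactOperator.exists_tendsto_ultrafilter {ι : Type*} (U : Ultrafilter ι)
    {A : E →L[ℝ] F} (hA : IsCompactOperator A) {x : ι → E} (hx : ∀ k, ‖x k‖ ≤ 1) :
    ∃ z, Tendsto (fun k => A (x k)) U (𝓝 z) := by
  obtain ⟨K, hK, hsub⟩ := IsCompactOperator.image_closedBall_subset_compact
    (f := (A : E →ₗ[ℝ] F)) hA 1
  obtain ⟨z, -, hz⟩ := hK.ultrafilter_le_nhds (U.map fun k => A (x k)) (by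
    rw [le_principal_iff]
    exact Filter.mem_map.2 (Eventually.of_forall fun k =>
      hsub ⟨x k, by simpa using hx k, rfl⟩))
  exact ⟨z, hz⟩

/-- Sequences of functionals in the unit ball have pointwise limits along ultrafilters. -/
theorem _root_.exists_tendsto_functional_ultrafilter {ι : Type*} (U : Ultrafilter ι)
    {φ : ι → E →L[ℝ] ℝ} (hφ : ∀ k, ‖φ k‖ ≤ 1) :
    ∃ ψ : E →L[ℝ] ℝ, ∀ x, Tendsto (fun k => φ k x) U (𝓝 (ψ x)) := by
  obtain ⟨ψ, -, hψ⟩ := (WeakDual.isCompact_closedBall (𝕜 := ℝ) (E := E) 0 1).ultrafilter_le_nhds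
    (U.map fun k => StrongDual.toWeakDual (φ k)) (by
      rw [le_principal_iff]
      exact Filter.mem_map.2 (Eventually.of_forall fun k => by simpa using hφ k))
  exact ⟨WeakDual.toStrongDual ψ, fun x => ((WeakDual.eval_continuous x).tendsto ψ).comp hψ⟩

/-- A power-compact positive operator with positive spectral radius `r` has a positive
eigenfunctional for `r`. -/
theorem exists_eigenfunctional [CompleteSpace E] {A : E →L[ℝ] E} (hA : OrderPositive A)
    {r : ℝ} (hr : Tendsto (fun n : ℕ => ‖A ^ n‖ ^ (1 / (n : ℝ))) atTop (𝓝 r)) (hr0 : 0 < r)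
    {n : ℕ} (hc : IsCompactOperator (A ^ n)) :
    ∃ φ : E →L[ℝ] ℝ, OrderPositive φ ∧ φ ≠ 0 ∧ ∀ x, φ (A x) = r * φ x := by
  choose φ hφ hφ1 hφε using fun k : ℕ =>
    hA.exists_approx_eigenfunctional hr hr0 (Nat.one_div_pos_of_nat (α := ℝ) (n := k))
  choose x _ hx1 hφx using fun k => (hφ k).exists_nonneg_half_norm_lt (by simp [hφ1])
  set U := hyperfilter ℕ
  have hU : (U : Filter ℕ) ≤ atTop := Nat.hyperfilter_le_atTop
  have happrox : Tendsto (fun k => φ k ∘L A - r • φ k) U (𝓝 0) :=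
    (squeeze_zero_norm hφε tendsto_one_div_add_atTop_nhds_zero_nat).mono_left hU
  have hpow : ∀ m : ℕ, Tendsto (fun k => φ k ∘L (A ^ m) - r ^ m • φ k) U (𝓝 0) := fun m => by
    have e : ∀ ψ : E →L[ℝ] ℝ, (((ContinuousLinearMap.compL ℝ E E ℝ).flip A) ^ m) ψ =
        ψ ∘L (A ^ m) := fun ψ => by
      induction m with
      | zero => rfl
      | succ m ih => rw [pow_succ', mul_apply_eq_comp, ih, pow_succ]; rfl
    simpa only [e] using pow_apply_sub_tendsto
      (A := (ContinuousLinearMap.compL ℝ E E ℝ).flip A) happrox m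
  obtain ⟨z, hz⟩ := hc.exists_tendsto_ultrafilter U hx1
  obtain ⟨ψ, hψ⟩ := exists_tendsto_functional_ultrafilter U fun k => (hφ1 k).le
  refine ⟨ψ, fun y hy => ge_of_tendsto' (hψ y) fun k => hφ k y hy, ?_, fun y => ?_⟩
  · rintro rfl
    have h1 : Tendsto (fun k => φ k ((A ^ n) (x k) - z)) U (𝓝 0) := by
      refine squeeze_zero_norm (fun k => (φ k).le_of_opNorm_le (hφ1 k).le _) ?_
      simpa using (tendsto_sub_nhds_zero_iff.2 hz).norm
    have h2 : Tendsto (fun k => (φ k ∘L (A ^ n) - r ^ n • φ k) (x k)) U (𝓝 0) := by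
      refine squeeze_zero_norm (fun k => ContinuousLinearMap.le_opNorm _ _) ?_
      refine squeeze_zero (fun k => by positivity)
        (fun k => mul_le_of_le_one_right (norm_nonneg _) (hx1 k)) ?_
      simpa using (hpow n).norm
    have h3 : Tendsto (fun k => r ^ n * φ k (x k)) U (𝓝 0) := by
      have := (h1.add (hψ z)).sub h2
      simp only [zero_apply, add_zero, sub_zero] at this
      refine this.congr fun k => ?_
      simp only [map_sub, sub_apply, ContinuousLinearMap.comp_apply, smul_apply, smul_eq_mul]
      ring
    have h4 : Tendsto (fun k => ‖φ k (x k)‖) U (𝓝 0) := by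
      have := (h3.const_mul (r ^ n)⁻¹).norm
      simpa [← mul_assoc, (pow_pos hr0 n).ne'] using this
    have h5 : (1 / 2 : ℝ) ≤ 0 := ge_of_tendsto' h4 fun k => by
      simpa only [hφ1 k] using (hφx k).le
    norm_num at h5
  · have h1 : Tendsto (fun k => (φ k ∘L A - r • φ k) y) U (𝓝 0) := by
      simpa [Function.comp_def] using ((ContinuousLinearMap.apply ℝ ℝ y).continuous.tendsto 0).comp happrox
    have h2 := (hψ (A y)).sub ((hψ y).const_mul r)
    exact sub_eq_zero.1 (tendsto_nhds_unique h2 h1)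

/-- A positive operator dominated by a power-compact operator with the same spectral radius has a
positive eigenvector, provided the dominating operator has a strictly positive eigenfunctional. -/
theorem exists_eigenvector [CompleteSpace E] {S T : E →L[ℝ] E} (hS : OrderPositive S)
    (hT : OrderPositive T) (hST : ∀ x, 0 ≤ x → S x ≤ T x)
    {r : ℝ} (hr : Tendsto (fun n : ℕ => ‖S ^ n‖ ^ (1 / (n : ℝ))) atTop (𝓝 r)) (hr0 : 0 < r)
    {n : ℕ} (hc : IsCompactOperator (T ^ n)) {φ : E →L[ℝ] ℝ} (hφ : OrderPositive φ)
    (hφT : ∀ x, φ (T x) = r * φ x) (hφ0 : ∀ x, φ |x| = 0 → x = 0) :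
    ∃ z, 0 ≤ z ∧ z ≠ 0 ∧ S z = r • z := by
  choose x hx0 hx1 hxε using fun k : ℕ =>
    hS.exists_approx_eigenvector hr hr0 (Nat.one_div_pos_of_nat (α := ℝ) (n := k))
  set U := hyperfilter ℕ
  have hU : (U : Filter ℕ) ≤ atTop := Nat.hyperfilter_le_atTop
  have happrox : Tendsto (fun k => S (x k) - r • x k) U (𝓝 0) :=
    (squeeze_zero_norm hxε tendsto_one_div_add_atTop_nhds_zero_nat).mono_left hU
  have hpow := pow_apply_sub_tendsto happrox n
  obtain ⟨z, hz⟩ := hc.exists_tendsto_ultrafilter U fun k => (hx1 k).le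
  have hle : ∀ k, (S ^ n) (x k) ≤ (T ^ n) (x k) := fun k => hS.pow_le_pow hT hST n (hx0 k)
  have hφpow : ∀ m y, φ ((T ^ m) y) = r ^ m * φ y := fun m y => by
    induction m with
    | zero => simp
    | succ m ih =>
      rw [pow_succ', mul_apply_eq_comp, hφT, ih]
      ring
  refine ⟨z, ge_of_tendsto' hz fun k => hT.pow n _ (hx0 k), ?_, ?_⟩
  · rintro rfl
    have h1 : Tendsto (fun k => (S ^ n) (x k)) U (𝓝 0) :=
      squeeze_zero_norm (fun k => norm_le_of_nonneg_of_le (hS.pow n _ (hx0 k)) (hle k))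
        (tendsto_zero_iff_norm_tendsto_zero.1 hz)
    have h2 : Tendsto (fun k => r ^ n • x k) U (𝓝 0) := by simpa using h1.sub hpow
    have h3 : Tendsto (fun _ : ℕ => r ^ n) U (𝓝 0) := by
      simpa [norm_smul, hx1, abs_of_pos hr0] using h2.norm
    exact (pow_pos hr0 n).ne' (tendsto_nhds_unique tendsto_const_nhds h3)
  · have hφabs : Continuous fun y : E => φ |y| := by
      have : Continuous fun y : E => |y| := continuous_id.sup continuous_neg
      exact φ.continuous.comp this
    have lim0 : ∀ {v : ℕ → E}, Tendsto v U (𝓝 0) → Tendsto (fun k => φ |v k|) U (𝓝 0) :=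
      fun hv => by simpa [Function.comp_def] using (hφabs.tendsto 0).comp hv
    have tri : ∀ y w : E, φ |y + w| ≤ φ |y| + φ |w| := fun y w => by
      rw [← map_add]
      exact hφ.mono (abs_add_le y w)
    have sm : ∀ (c : ℝ) (y : E), φ |c • y| ≤ |c| * φ |y| := fun c y => by
      simpa using hφ.mono (abs_real_smul_le c y)
    have hd : Tendsto (fun k => φ |z - r ^ n • x k|) U (𝓝 0) := by
      have hz' : Tendsto (fun k => z - (T ^ n) (x k)) U (𝓝 0) := by simpa using hz.const_sub z
      have hφp : Tendsto (fun k => -φ ((S ^ n) (x k) - r ^ n • x k)) U (𝓝 0) := by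
        simpa using ((φ.continuous.tendsto 0).comp hpow).neg
      have := ((lim0 hz').add hφp).add (lim0 hpow)
      simp only [add_zero] at this
      refine squeeze_zero (fun k => hφ _ (abs_nonneg _)) (fun k => ?_) this
      have e : z - r ^ n • x k = (z - (T ^ n) (x k)) + ((T ^ n) (x k) - (S ^ n) (x k)) +
        ((S ^ n) (x k) - r ^ n • x k) := by abel
      have e2 : φ |(T ^ n) (x k) - (S ^ n) (x k)| = -φ ((S ^ n) (x k) - r ^ n • x k) := by
        rw [abs_of_nonneg (sub_nonneg.2 (hle k))]
        rw [map_sub, map_sub, map_smul, hφpow, smul_eq_mul, neg_sub]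
      rw [← e2]
      conv_lhs => rw [e]
      exact (tri _ _).trans (by gcongr; exact tri _ _)
    have hlim := ((hd.const_mul r).add ((lim0 happrox).const_mul |r ^ n|)).add (hd.const_mul |r|)
    simp only [mul_zero, add_zero] at hlim
    rw [← sub_eq_zero]
    refine hφ0 _ (le_antisymm (ge_of_tendsto' hlim fun k => ?_) (hφ _ (abs_nonneg _)))
    have e : S z - r • z = S (z - r ^ n • x k) + r ^ n • (S (x k) - r • x k) +
        r • (-(z - r ^ n • x k)) := by
      rw [map_sub, map_smul]
      module
    rw [e]
    refine (tri _ _).trans (add_le_add ((tri _ _).trans (add_le_add ?_ (sm _ _))) ?_)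
    · rw [← hφT]
      exact hφ.mono ((hS.abs_apply_le _).trans (hST _ (abs_nonneg _)))
    · simpa only [abs_neg] using sm r (-(z - r ^ n • x k))

end OrderPositive

/-- An operator is ideal-irreducible if it leaves no non-trivial closed ideal invariant. -/
def IdealIrreducible (T : E →L[ℝ] E) : Prop :=
  ∀ I : Submodule ℝ E, IsClosed (I : Set E) →
    (∀ x y : E, |x| ≤ |y| → y ∈ I → x ∈ I) → (∀ x ∈ I, T x ∈ I) → I = ⊥ ∨ I = ⊤

/-- The null ideal of a positive operator. -/
def nullIdeal {A : E →L[ℝ] F} (hA : OrderPositive A) : Submodule ℝ E where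
  carrier := {x | A |x| = 0}
  zero_mem' := by simp
  add_mem' {x y} hx hy := by
    refine le_antisymm ((hA.mono (abs_add_le x y)).trans_eq ?_) (hA _ (abs_nonneg _))
    rw [map_add, Set.mem_ofPred.1 hx, Set.mem_ofPred.1 hy, add_zero]
  smul_mem' c x hx := by
    refine le_antisymm ((hA.mono (abs_real_smul_le c x)).trans_eq ?_) (hA _ (abs_nonneg _))
    rw [map_smul, Set.mem_ofPred.1 hx, smul_zero]

theorem IdealIrreducible.strictly_positive {T : E →L[ℝ] E} (hirr : IdealIrreducible T)
    (hT : OrderPositive T) {A : E →L[ℝ] F} (hA : OrderPositive A) (hA0 : A ≠ 0)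
    (hAT : ∀ x, 0 ≤ x → A x = 0 → A (T x) = 0) {x : E} (hx : A |x| = 0) : x = 0 := by
  have hcont : Continuous fun y : E => A |y| :=
    A.continuous.comp (continuous_id.sup continuous_neg)
  rcases hirr (nullIdeal hA) (isClosed_singleton.preimage hcont)
    (fun y z hyz hz => le_antisymm ((hA.mono hyz).trans_eq hz) (hA _ (abs_nonneg _)))
    (fun y hy => le_antisymm
      ((hA.mono (hT.abs_apply_le y)).trans_eq (hAT _ (abs_nonneg y) hy)) (hA _ (abs_nonneg _)))
    with h | h
  · exact (Submodule.mem_bot ℝ).1 (h ▸ (hx : x ∈ nullIdeal hA))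
  · refine absurd (ContinuousLinearMap.ext fun y => ?_) hA0
    have hy : A |y| = 0 := (h ▸ Submodule.mem_top : y ∈ nullIdeal hA)
    have := hA.norm_apply_le y
    rw [hy, norm_zero] at this
    simpa using this

/-- The closure of a solid subspace is solid. -/
theorem solid_closure {J : Submodule ℝ E} (hJ : ∀ x y : E, |x| ≤ |y| → y ∈ J → x ∈ J)
    {x y : E} (hxy : |x| ≤ |y|) (hy : y ∈ J.topologicalClosure) : x ∈ J.topologicalClosure := by
  obtain ⟨u, hu, hlim⟩ := mem_closure_iff_seq_limit.1 hy
  refine mem_closure_iff_seq_limit.2 ⟨fun k => (x ⊓ |u k|) ⊔ -|u k|, fun k => ?_, ?_⟩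
  · refine hJ _ _ ?_ (hu k)
    refine abs_le'.2 ⟨sup_le inf_le_right ?_, neg_le.1 le_sup_right⟩
    exact (neg_nonpos.2 (abs_nonneg _)).trans (abs_nonneg _)
  · have hcont : Continuous fun v : E => (x ⊓ |v|) ⊔ -|v| := by
      have : Continuous fun v : E => |v| := continuous_id.sup continuous_neg
      exact (continuous_const.inf this).sup this.neg
    have hx : (x ⊓ |y|) ⊔ -|y| = x := by
      rw [inf_eq_left.2 ((le_abs_self x).trans hxy), sup_eq_left]
      exact neg_le.1 ((neg_le_abs x).trans hxy)
    have := (hcont.tendsto y).comp hlim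
    rwa [hx] at this

/-- The operator `N (1 + T + ⋯ + T ^ (N - 1))`. -/
def orbitSum (T : E →L[ℝ] E) (N : ℕ) : E →L[ℝ] E :=
  (N : ℝ) • ∑ k ∈ Finset.range N, T ^ k

namespace OrderPositive

variable {T : E →L[ℝ] E} (hT : OrderPositive T)
include hT

theorem orbitSum (N : ℕ) : OrderPositive (orbitSum T N) :=
  (sum fun k _ => hT.pow k).smul N.cast_nonneg

theorem smul_sum_le {y : E} (hy : 0 ≤ y) {c d : ℝ} {N M : ℕ} (hc : 0 ≤ c) (hcd : c ≤ d)
    (hNM : N ≤ M) :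
    c • (∑ k ∈ Finset.range N, T ^ k) y ≤ d • (∑ k ∈ Finset.range M, T ^ k) y := by
  have h1 : (∑ k ∈ Finset.range N, T ^ k) y ≤ (∑ k ∈ Finset.range M, T ^ k) y := by
    rw [sum_apply, sum_apply]
    exact Finset.sum_le_sum_of_subset_of_nonneg (Finset.range_mono hNM)
      fun k _ _ => hT.pow k y hy
  refine (real_smul_le_smul hc h1).trans ?_
  rw [← sub_nonneg, ← sub_smul]
  exact real_smul_nonneg (sub_nonneg.2 hcd) (sum (fun k _ => hT.pow k) y hy)

theorem orbitSum_mono {y : E} (hy : 0 ≤ y) {N M : ℕ} (hNM : N ≤ M) :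
    _root_.orbitSum T N y ≤ _root_.orbitSum T M y :=
  hT.smul_sum_le hy N.cast_nonneg (Nat.cast_le.2 hNM) hNM

/-- The invariant ideal generated by a positive vector. -/
def orbitIdeal {y : E} (hy : 0 ≤ y) : Submodule ℝ E where
  carrier := {x | ∃ N, |x| ≤ _root_.orbitSum T N y}
  zero_mem' := ⟨0, by simp [_root_.orbitSum]⟩
  add_mem' := by
    rintro u v ⟨N, hN⟩ ⟨M, hM⟩
    refine ⟨N + M, (abs_add_le u v).trans ((add_le_add hN hM).trans ?_)⟩
    simp only [_root_.orbitSum, smul_apply, Nat.cast_add, add_smul]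
    exact add_le_add (hT.smul_sum_le hy N.cast_nonneg le_rfl (Nat.le_add_right N M))
      (hT.smul_sum_le hy M.cast_nonneg le_rfl (Nat.le_add_left M N))
  smul_mem' := by
    rintro c u ⟨N, hN⟩
    refine ⟨⌈|c| * N⌉₊ + N, (abs_real_smul_le c u).trans
      ((real_smul_le_smul (abs_nonneg c) hN).trans ?_)⟩
    rw [_root_.orbitSum, _root_.orbitSum, smul_apply, smul_apply, smul_smul]
    refine hT.smul_sum_le hy (by positivity) ?_ (Nat.le_add_left _ _)
    push_cast
    linarith [Nat.le_ceil (|c| * N), N.cast_nonneg (α := ℝ)]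

theorem orbitIdeal_solid {y : E} (hy : 0 ≤ y) {u v : E} (huv : |u| ≤ |v|)
    (hv : v ∈ hT.orbitIdeal hy) : u ∈ hT.orbitIdeal hy := by
  obtain ⟨N, hN⟩ := hv
  exact ⟨N, huv.trans hN⟩

theorem orbitIdeal_invariant {y : E} (hy : 0 ≤ y) {u : E} (hu : u ∈ hT.orbitIdeal hy) :
    T u ∈ hT.orbitIdeal hy := by
  obtain ⟨N, hN⟩ := hu
  refine ⟨N + 1, (hT.abs_apply_le u).trans ((hT.mono hN).trans ?_)⟩
  have h1 : T (_root_.orbitSum T N y) ≤ (N : ℝ) • (∑ k ∈ Finset.range (N + 1), T ^ k) y := by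
    rw [_root_.orbitSum, smul_apply, map_smul]
    refine real_smul_le_smul N.cast_nonneg ?_
    rw [Finset.sum_range_succ', add_apply, sum_apply, sum_apply, map_sum]
    simp only [pow_succ', mul_apply_eq_comp]
    exact le_add_of_nonneg_right hy
  exact h1.trans (hT.smul_sum_le hy N.cast_nonneg (by simp) le_rfl)

theorem exists_orbitSum_near (hirr : IdealIrreducible T) {y : E} (hy : 0 ≤ y) (hy0 : y ≠ 0)
    (x : E) {ε : ℝ} (hε : 0 < ε) : ∃ u N, |u| ≤ _root_.orbitSum T N y ∧ ‖u - x‖ < ε := by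
  have hymem : y ∈ hT.orbitIdeal hy := ⟨1, by simp [_root_.orbitSum, abs_of_nonneg hy]⟩
  rcases hirr (hT.orbitIdeal hy).topologicalClosure
    (Submodule.isClosed_topologicalClosure _)
    (fun u v huv hv => solid_closure (fun _ _ => hT.orbitIdeal_solid hy) huv hv)
    (fun u hu => map_mem_closure T.continuous hu fun v hv => hT.orbitIdeal_invariant hy hv)
    with h | h
  · exact absurd ((Submodule.mem_bot ℝ).1 (h ▸ Submodule.le_topologicalClosure _ hymem)) hy0
  · have hx : x ∈ closure (hT.orbitIdeal hy : Set E) :=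
      (h ▸ Submodule.mem_top : x ∈ (hT.orbitIdeal hy).topologicalClosure)
    obtain ⟨u, ⟨N, hN⟩, hux⟩ := Metric.mem_closure_iff.1 hx ε hε
    exact ⟨u, N, hN, by rwa [← dist_eq_norm, dist_comm]⟩

/-- A non-zero ideal-irreducible power-compact positive operator has positive spectral radius. -/
theorem spectral_radius_ne_zero (hirr : IdealIrreducible T) (hT0 : T ≠ 0) {n : ℕ} (hn : 1 ≤ n)
    (hc : IsCompactOperator (T ^ n)) :
    ¬ Tendsto (fun n : ℕ => ‖T ^ n‖ ^ (1 / (n : ℝ))) atTop (𝓝 0) := by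
  intro hr
  have hker : ∀ m x, 0 ≤ x → (T ^ m) x = 0 → x = 0 := fun m => by
    induction m with
    | zero => exact fun x _ hx => hx
    | succ m ih =>
      intro x hx h
      rw [pow_succ, mul_apply_eq_comp] at h
      refine hirr.strictly_positive hT hT hT0 (fun y _ hy => by rw [hy, map_zero]) ?_
      rw [abs_of_nonneg hx]
      exact ih _ (hT x hx) h
  obtain ⟨x, hx, hx0⟩ : ∃ x : E, 0 ≤ x ∧ x ≠ 0 := by
    by_contra! h
    refine hT0 (ContinuousLinearMap.ext fun x => ?_)
    rw [eq_zero_of_abs_eq_zero (h |x| (abs_nonneg x)), map_zero, map_zero]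
  have hTx : 0 < ‖(T ^ n) x‖ := norm_pos_iff.2 fun h => hx0 (hker n x hx h)
  have hxn : 0 < ‖x‖ := norm_pos_iff.2 hx0
  obtain ⟨ε, hε, hεx, hεT⟩ : ∃ ε : ℝ, 0 < ε ∧ ε ≤ ‖x‖ / 2 ∧ ‖T ^ n‖ * ε ≤ ‖(T ^ n) x‖ / 2 := by
    refine ⟨min (‖x‖ / 2) (‖(T ^ n) x‖ / 2 / (‖T ^ n‖ + 1)), by positivity, min_le_left _ _, ?_⟩
    calc ‖T ^ n‖ * _ ≤ (‖T ^ n‖ + 1) * (‖(T ^ n) x‖ / 2 / (‖T ^ n‖ + 1)) := by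
          gcongr
          · linarith
          · exact min_le_right _ _
      _ = _ := mul_div_cancel₀ _ (by positivity)
  set K := closure ((T ^ n) '' Metric.ball x ε) with hK
  have hKc : IsCompact K :=
    IsCompactOperator.isCompact_closure_image_of_bounded (f := (↑(T ^ n) : E →ₗ[ℝ] E)) hc
      Metric.isBounded_ball
  have hK0 : ∀ y ∈ K, y ≠ 0 := by
    have hsub : K ⊆ {y | ‖(T ^ n) x‖ / 2 ≤ ‖y‖} := by
      refine closure_minimal ?_ (isClosed_le continuous_const continuous_norm)
      rintro _ ⟨w, hw, rfl⟩
      have h1 := (T ^ n).le_opNorm (x - w)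
      have h2 : ‖T ^ n‖ * ‖x - w‖ ≤ ‖T ^ n‖ * ε := by
        gcongr
        rw [← dist_eq_norm, dist_comm]
        exact (Metric.mem_ball.1 hw).le
      have h3 := norm_sub_norm_le ((T ^ n) x) ((T ^ n) w)
      rw [map_sub] at h1
      simp only [Set.mem_ofPred_eq]
      linarith
    rintro y hy rfl
    have := hsub hy
    simp only [Set.mem_ofPred_eq, norm_zero] at this
    linarith
  obtain ⟨N, hN⟩ : ∃ N, ∀ y ∈ K, ∃ w ∈ Metric.ball x ε, |w| ≤ _root_.orbitSum T N |y| := by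
    refine hKc.induction_on (p := fun s => ∃ N, ∀ y ∈ s, ∃ w ∈ Metric.ball x ε,
      |w| ≤ _root_.orbitSum T N |y|) ⟨0, by simp⟩ ?_ ?_ ?_
    · rintro s t hst ⟨N, hN⟩
      exact ⟨N, fun y hy => hN y (hst hy)⟩
    · rintro s t ⟨N, hN⟩ ⟨M, hM⟩
      refine ⟨max N M, ?_⟩
      rintro y (hy | hy)
      · obtain ⟨w, hw, h⟩ := hN y hy
        exact ⟨w, hw, h.trans (hT.orbitSum_mono (abs_nonneg y) (le_max_left N M))⟩
      · obtain ⟨w, hw, h⟩ := hM y hy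
        exact ⟨w, hw, h.trans (hT.orbitSum_mono (abs_nonneg y) (le_max_right N M))⟩
    · intro y hy
      obtain ⟨u, N, huN, hux⟩ := hT.exists_orbitSum_near hirr (abs_nonneg y)
        (fun h => hK0 y hy (eq_zero_of_abs_eq_zero h)) x hε
      have hcont : Continuous fun z : E => |u| ⊓ _root_.orbitSum T N |z| := by
        have : Continuous fun v : E => |v| := continuous_id.sup continuous_neg
        exact continuous_const.inf ((_root_.orbitSum T N).continuous.comp this)
      have hmem : |u| ⊓ _root_.orbitSum T N |y| ∈ Metric.ball x ε := by
        rw [inf_eq_left.2 huN, Metric.mem_ball, dist_eq_norm]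
        refine lt_of_le_of_lt ?_ hux
        simpa only [abs_of_nonneg hx] using norm_abs_sub_abs u x
      refine ⟨_, mem_nhdsWithin_of_mem_nhds
        (hcont.continuousAt.preimage_mem_nhds (Metric.isOpen_ball.mem_nhds hmem)), N,
        fun z hz => ⟨_, hz, ?_⟩⟩
      rw [abs_of_nonneg (le_inf (abs_nonneg u) (hT.orbitSum N _ (abs_nonneg z)))]
      exact inf_le_right
  set G := _root_.orbitSum T N with hG
  have hGpos : OrderPositive G := hT.orbitSum N
  have hiter : ∀ j : ℕ, ∃ w ∈ Metric.ball x ε, |w| ≤ ((G * T ^ n) ^ j) x := fun j => by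
    induction j with
    | zero => exact ⟨x, Metric.mem_ball_self hε, by simp [abs_of_nonneg hx]⟩
    | succ j ih =>
      obtain ⟨w, hw, hwj⟩ := ih
      obtain ⟨v, hv, hvw⟩ := hN ((T ^ n) w) (subset_closure ⟨w, hw, rfl⟩)
      refine ⟨v, hv, hvw.trans ?_⟩
      rw [pow_succ', mul_apply_eq_comp]
      refine hGpos.mono (((hT.pow n).abs_apply_le w).trans ((hT.pow n).mono hwj))
  have hcomm : Commute G (T ^ n) :=
    ((Commute.sum_left _ _ _ fun k _ => Commute.pow_pow_self T k n).smul_left (N : ℝ))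
  obtain ⟨μ, hμ0, hμ1, hμG⟩ : ∃ μ : ℝ, 0 < μ ∧ μ ≤ 1 ∧ ‖G‖ * μ < 1 := by
    refine ⟨(‖G‖ + 1)⁻¹, by positivity, inv_le_one_of_one_le₀ (by simp), ?_⟩
    rw [← div_eq_mul_inv, div_lt_one (by positivity)]
    linarith
  have hpow := eventually_lt_pow_of_tendsto_root (fun m => norm_nonneg (T ^ m)) hr hμ0
  have hzero : Tendsto (fun j : ℕ => (‖G‖ * μ) ^ j * ‖x‖) atTop (𝓝 0) := by
    simpa using (tendsto_pow_atTop_nhds_zero_of_lt_one (by positivity) hμG).mul_const ‖x‖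
  obtain ⟨j, ⟨hj1, hj2⟩, hj0⟩ := ((((tendsto_id.const_mul_atTop' hn).eventually hpow).and
    (hzero.eventually_lt_const (half_pos hxn))).and (eventually_gt_atTop 0)).exists
  obtain ⟨w, hw, hwj⟩ := hiter j
  have h1 : ‖w‖ ≤ (‖G‖ * μ) ^ j * ‖x‖ := by
    rw [← norm_abs_eq_norm w]
    refine (norm_le_of_nonneg_of_le (abs_nonneg w) hwj).trans ?_
    refine ContinuousLinearMap.le_of_opNorm_le _ ?_ x
    rw [hcomm.mul_pow, ← pow_mul, mul_pow]
    refine (norm_mul_le _ _).trans ?_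
    gcongr
    · exact norm_pow_le' G hj0
    · exact hj1.le.trans (pow_le_pow_of_le_one hμ0.le hμ1 (Nat.le_mul_of_pos_left j hn))
  have h2 := norm_sub_norm_le x w
  rw [Metric.mem_ball, dist_comm, dist_eq_norm] at hw
  linarith

end OrderPositive

end BanachLattice

/-- Let `0 ≤ S ≤ T` be positive operators on a Banach lattice `E` with equal
spectral radii (`r(T) = lim ‖Tⁿ‖^{1/n}`). If `T` is ideal-irreducible and power-compact,
then `S = T`. -/
theorem stmt6 {E : Type*} [NormedAddCommGroup E] [Lattice E] [HasSolidNorm E]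
    [IsOrderedAddMonoid E] [NormedSpace ℝ E] [CompleteSpace E]
    (S T : E →L[ℝ] E)
    (hS : ∀ x : E, 0 ≤ x → 0 ≤ S x)
    (hST : ∀ x : E, 0 ≤ x → 0 ≤ (T - S) x)
    -- the spectral radii `r(S) = lim ‖Sⁿ‖^{1/n}` and `r(T) = lim ‖Tⁿ‖^{1/n}` coincide:
    (hr : ∃ r : ℝ,
      Tendsto (fun n : ℕ => ‖S ^ n‖ ^ (1 / (n : ℝ))) atTop (𝓝 r) ∧
      Tendsto (fun n : ℕ => ‖T ^ n‖ ^ (1 / (n : ℝ))) atTop (𝓝 r))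
    -- `T` is ideal-irreducible: no non-trivial closed ideal of `E` is invariant under `T`:
    (hirr : ∀ I : Submodule ℝ E, IsClosed (I : Set E) →
      (∀ x y : E, |x| ≤ |y| → y ∈ I → x ∈ I) → (∀ x ∈ I, T x ∈ I) → I = ⊥ ∨ I = ⊤)
    -- `T` is power-compact:
    (hpc : ∃ n : ℕ, 1 ≤ n ∧ IsCompactOperator ⇑(T ^ n)) :
    S = T := by
  obtain ⟨r, hrS, hrT⟩ := hr
  obtain ⟨n, hn, hc⟩ := hpc
  have hSpos : OrderPositive S := hS
  have hle : ∀ x : E, 0 ≤ x → S x ≤ T x := fun x hx => sub_nonneg.1 (hST x hx)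
  have hTpos : OrderPositive T := fun x hx => (hS x hx).trans (hle x hx)
  have hI : IdealIrreducible T := hirr
  by_cases hT0 : T = 0
  · have := hSpos.opNorm_le hle
    rw [hT0, norm_zero] at this
    rw [hT0, norm_le_zero_iff.1 this]
  have hr0 : 0 < r := by
    refine lt_of_le_of_ne (ge_of_tendsto' hrT fun k => by positivity) ?_
    rintro rfl
    exact hTpos.spectral_radius_ne_zero hI hT0 hn hc hrT
  obtain ⟨φ, hφ, hφ0, hφT⟩ := hTpos.exists_eigenfunctional hrT hr0 hc
  have hφ1 : ∀ x, φ |x| = 0 → x = 0 := fun x hx =>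
    hI.strictly_positive hTpos hφ hφ0 (fun y _ hy => by rw [hφT, hy, mul_zero]) hx
  obtain ⟨z, hz, hz0, hSz⟩ := hSpos.exists_eigenvector hTpos hle hrS hr0 hc hφ hφT hφ1
  have hTz : T z = r • z := by
    refine sub_eq_zero.1 (hφ1 _ ?_)
    rw [abs_of_nonneg (sub_nonneg.2 (hSz ▸ hle z hz)), map_sub, hφT, map_smul, smul_eq_mul,
      sub_self]
  have hD : OrderPositive (T - S) := hST
  have horb : ∀ N, (T - S) (orbitSum T N z) = 0 := fun N => by
    have hk : ∀ k : ℕ, (T ^ k) z = r ^ k • z := fun k => by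
      induction k with
      | zero => simp
      | succ k ih =>
        rw [pow_succ', mul_apply_eq_comp, ih, map_smul, hTz, smul_smul,
          pow_succ]
    rw [orbitSum, smul_apply, sum_apply, map_smul, map_sum]
    simp [hk, hSz, hTz]
  have hclosed : IsClosed {u : E | (T - S) u = 0} := isClosed_singleton.preimage (T - S).continuous
  have hzero : ∀ x, (T - S) x = 0 := fun x => by
    refine hclosed.closure_subset (Metric.mem_closure_iff.2 fun ε hε => ?_)
    obtain ⟨u, N, hu, hux⟩ := hTpos.exists_orbitSum_near hI hz hz0 x hε
    refine ⟨u, ?_, by rwa [dist_comm, dist_eq_norm]⟩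
    have h := le_antisymm ((hD.mono hu).trans_eq (horb N)) (hD _ (abs_nonneg u))
    have h2 := hD.norm_apply_le u
    rw [h, norm_zero] at h2
    exact norm_le_zero_iff.1 h2
  exact (sub_eq_zero.1 (ContinuousLinearMap.ext hzero)).symm
end

section
/- Let A and B be positive bounded linear operators on a Banach lattice E such that the commutator AB − BA is a positive operator. If for some natural number n ≥ 1 one of the operators Aⁿ and Bⁿ is compact, then the operator (AB)^{3n} is compact; in particular, AB is power-compact. -/
section RealVectorSpace

variable {V W : Type*} [AddCommGroup V] [Module ℝ V] [AddCommGroup W] [Module ℝ W]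

theorem exists_comp_eq_of_le_sublinear (d : W →ₗ[ℝ] V) (f : W →ₗ[ℝ] ℝ) (p : V → ℝ)
    (p_hom : ∀ c : ℝ, 0 < c → ∀ x, p (c • x) = c * p x) (p_add : ∀ x y, p (x + y) ≤ p x + p y)
    (hf : ∀ w, f w ≤ p (d w)) :
    ∃ g : V →ₗ[ℝ] ℝ, (∀ w, g (d w) = f w) ∧ ∀ v, g v ≤ p v := by
  have p_zero : p 0 = 0 := by
    have := p_hom 2 two_pos 0
    rw [smul_zero] at this
    linarith
  have hmem : f ∈ LinearMap.range d.dualMap := by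
    rw [LinearMap.range_dualMap_eq_dualAnnihilator_ker, Submodule.mem_dualAnnihilator]
    intro w hw
    rw [LinearMap.mem_ker] at hw
    have h1 := hf w
    have h2 := hf (-w)
    simp only [map_neg, hw, neg_zero, p_zero] at h1 h2
    linarith
  obtain ⟨F, rfl⟩ := hmem
  obtain ⟨g, hg, hgp⟩ := exists_extension_of_le_sublinear
    ⟨LinearMap.range d, F.domRestrict (LinearMap.range d)⟩ p p_hom p_add (by
      rintro ⟨_, w, rfl⟩
      exact hf w)
  exact ⟨g, fun w => hg ⟨d w, w, rfl⟩, hgp⟩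

theorem exists_le_sublinear_eq (p : V → ℝ)
    (p_hom : ∀ c : ℝ, 0 < c → ∀ x, p (c • x) = c * p x) (p_add : ∀ x y, p (x + y) ≤ p x + p y)
    (y : V) : ∃ g : V →ₗ[ℝ] ℝ, g y = p y ∧ ∀ v, g v ≤ p v := by
  have p_zero : p 0 = 0 := by
    have := p_hom 2 two_pos 0
    rw [smul_zero] at this
    linarith
  obtain ⟨g, hg, hgp⟩ := exists_comp_eq_of_le_sublinear (LinearMap.toSpanSingleton ℝ V y)
    (LinearMap.toSpanSingleton ℝ ℝ (p y)) p p_hom p_add (by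
      intro c
      simp only [LinearMap.toSpanSingleton_apply, smul_eq_mul]
      rcases lt_trichotomy c 0 with hc | rfl | hc
      · have h1 := p_add (c • y) ((-c) • y)
        rw [← add_smul, add_neg_cancel, zero_smul, p_zero, p_hom (-c) (by linarith)] at h1
        linarith
      · simp [p_zero]
      · rw [p_hom c hc])
  exact ⟨g, by simpa using hg 1, hgp⟩

end RealVectorSpace

theorem sum_sq_sub_mul_div_eq {K : Type*} [Fintype K] (s t : K → ℝ)
    (hs : ∀ k, 0 ≤ s k) (hst : ∀ k, s k ≤ t k) :
    ∑ k, (s k - (∑ l, s l) / (∑ l, t l) * t k) ^ 2 / t k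
      = ∑ k, s k ^ 2 / t k - (∑ k, s k) ^ 2 / ∑ k, t k := by
  set σ := ∑ l, s l with hσ
  set τ := ∑ l, t l with hτ
  have hterm : ∀ k, (s k - σ / τ * t k) ^ 2 / t k
      = s k ^ 2 / t k - 2 * (σ / τ) * s k + (σ / τ) ^ 2 * t k := by
    intro k
    rcases eq_or_ne (t k) 0 with h | h
    · have : s k = 0 := le_antisymm (h ▸ hst k) (hs k)
      simp [h, this]
    · field_simp
      ring
  simp_rw [hterm]
  rw [Finset.sum_add_distrib, Finset.sum_sub_distrib, ← Finset.mul_sum, ← Finset.mul_sum,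
    ← hσ, ← hτ]
  rcases eq_or_ne τ 0 with h | h
  · simp [h]
  · field_simp
    ring

section LatticeOrderedGroup

variable {G : Type*} [AddCommGroup G] [Lattice G] [IsOrderedAddMonoid G]

theorem posPart_add_le_add_posPart (x y : G) : (x + y)⁺ ≤ x⁺ + y⁺ :=
  sup_le (add_le_add (le_posPart x) (le_posPart y))
    (add_nonneg (posPart_nonneg x) (posPart_nonneg y))

theorem exists_riesz_decomposition {I : Type*} (s : Finset I) {a : I → G}
    (ha : ∀ i, 0 ≤ a i) {x : G} (hx : 0 ≤ x) (hxa : x ≤ ∑ i ∈ s, a i) :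
    ∃ b : I → G, (∀ i, 0 ≤ b i ∧ b i ≤ a i) ∧ ∑ i ∈ s, b i = x := by
  classical
  induction s using Finset.induction_on generalizing x with
  | empty =>
    refine ⟨0, fun i => ⟨le_rfl, ha i⟩, ?_⟩
    simpa using le_antisymm hx (by simpa using hxa)
  | insert i s hi ih =>
    rw [Finset.sum_insert hi] at hxa
    have hrest : x - x ⊓ a i ≤ ∑ j ∈ s, a j := by
      rw [sub_le_comm, le_inf_iff]
      exact ⟨sub_le_self _ (Finset.sum_nonneg fun j _ => ha j), by rwa [sub_le_iff_le_add]⟩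
    obtain ⟨b, hb, hsum⟩ := ih (sub_nonneg.2 inf_le_left) hrest
    refine ⟨Function.update b i (x ⊓ a i), fun j => ?_, ?_⟩
    · rcases eq_or_ne j i with rfl | hj
      · simp [hx, ha j]
      · simpa [hj] using hb j
    · rw [Finset.sum_insert hi, Function.update_self, Finset.sum_update_of_notMem hi, hsum]
      abel

theorem LinearMap.monotone_of_nonneg [Module ℝ G] {F : Type*} [AddCommGroup F] [PartialOrder F]
    [IsOrderedAddMonoid F] [Module ℝ F] {f : G →ₗ[ℝ] F} (hf : ∀ x, 0 ≤ x → 0 ≤ f x) :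
    Monotone f := fun x y h => by
  have := hf (y - x) (sub_nonneg.2 h)
  rwa [map_sub, sub_nonneg] at this

theorem LinearMap.abs_apply_le_of_nonneg [Module ℝ G] {f : G →ₗ[ℝ] ℝ}
    (hf : ∀ x, 0 ≤ x → 0 ≤ f x) (x : G) :
    |f x| ≤ f |x| := by
  refine abs_le.2 ⟨?_, monotone_of_nonneg hf (le_abs_self x)⟩
  have := monotone_of_nonneg hf (neg_le.1 (neg_le_abs x))
  rwa [map_neg] at this

end LatticeOrderedGroup

theorem norm_le_norm_of_nonneg_of_le {E : Type*} [NormedAddCommGroup E] [Lattice E] [HasSolidNorm E]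
    [IsOrderedAddMonoid E] {x y : E} (hx : 0 ≤ x) (hxy : x ≤ y) : ‖x‖ ≤ ‖y‖ :=
  norm_le_norm_of_abs_le_abs (by rwa [abs_of_nonneg hx, abs_of_nonneg (hx.trans hxy)])

section Energy

variable {E : Type*} [NormedAddCommGroup E] [Lattice E] [IsOrderedAddMonoid E] [NormedSpace ℝ E]
  {S T : E →L[ℝ] E}

/-- The discretised energy of `S` relative to `T` along vectors `a` and functionals `f`. -/
noncomputable def relativeEnergy (S T : E →L[ℝ] E) {I J : Type} [Fintype I] [Fintype J]
    (a : I → E) (f : J → E →ₗ[ℝ] ℝ) : ℝ :=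
  ∑ i, ∑ j, f j (S (a i)) ^ 2 / f j (T (a i))

theorem relativeEnergy_le (hS : ∀ x, 0 ≤ x → 0 ≤ S x) (hST : ∀ x, 0 ≤ x → S x ≤ T x)
    {I J : Type} [Fintype I] [Fintype J] {a : I → E} (ha : ∀ i, 0 ≤ a i)
    {f : J → E →ₗ[ℝ] ℝ} (hf : ∀ j x, 0 ≤ x → 0 ≤ f j x) :
    relativeEnergy S T a f ≤ ∑ i, ∑ j, f j (T (a i)) := by
  refine Finset.sum_le_sum fun i _ => Finset.sum_le_sum fun j _ => ?_
  have h0 : 0 ≤ f j (S (a i)) := hf j _ (hS _ (ha i))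
  have h1 : f j (S (a i)) ≤ f j (T (a i)) :=
    LinearMap.monotone_of_nonneg (hf j) (hST _ (ha i))
  refine div_le_of_le_mul₀ (h0.trans h1) (h0.trans h1) ?_
  rw [sq]
  exact mul_self_le_mul_self h0 h1

/-- Splitting `a i` into `b i` and `a i - b i`, and `f j` into `k j` and `f j - k j`, raises the
energy at least by the weighted defect at the cells `(b i, k j)`. -/
theorem sum_defect_le_relativeEnergy_sub (hS : ∀ x, 0 ≤ x → 0 ≤ S x)
    (hST : ∀ x, 0 ≤ x → S x ≤ T x)
    {I J : Type} [Fintype I] [Fintype J] {a b : I → E} (hb : ∀ i, 0 ≤ b i ∧ b i ≤ a i)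
    {f k : J → E →ₗ[ℝ] ℝ} (hk : ∀ j x, 0 ≤ x → 0 ≤ k j x ∧ k j x ≤ f j x) :
    ∑ i, ∑ j, (k j (S (b i)) - f j (S (a i)) / f j (T (a i)) * k j (T (b i))) ^ 2 / k j (T (b i))
      ≤ relativeEnergy S T (fun p : I × Bool => if p.2 then b p.1 else a p.1 - b p.1)
          (fun q : J × Bool => if q.2 then k q.1 else f q.1 - k q.1)
        - relativeEnergy S T a f := by
  have hcell : ∀ i j,
      (k j (S (b i)) - f j (S (a i)) / f j (T (a i)) * k j (T (b i))) ^ 2 / k j (T (b i))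
      ≤ (k j (S (b i)) ^ 2 / k j (T (b i))
          + (f j - k j) (S (b i)) ^ 2 / (f j - k j) (T (b i))
          + (k j (S (a i - b i)) ^ 2 / k j (T (a i - b i))
          + (f j - k j) (S (a i - b i)) ^ 2 / (f j - k j) (T (a i - b i))))
        - f j (S (a i)) ^ 2 / f j (T (a i)) := by
    intro i j
    let x : Bool → E := fun c => if c then b i else a i - b i
    let g : Bool → E →ₗ[ℝ] ℝ := fun c => if c then k j else f j - k j
    have hx : ∀ c, 0 ≤ x c := by
      rintro (_ | _)
      · simpa [x] using (hb i).2
      · simpa [x] using (hb i).1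
    have hg : ∀ c y, 0 ≤ y → 0 ≤ g c y := by
      rintro (_ | _) y hy
      · simpa [g] using (hk j y hy).2
      · simpa [g] using (hk j y hy).1
    have hs : ∀ p : Bool × Bool, 0 ≤ g p.2 (S (x p.1)) := fun p => hg _ _ (hS _ (hx _))
    have hst : ∀ p : Bool × Bool, g p.2 (S (x p.1)) ≤ g p.2 (T (x p.1)) := fun p =>
      LinearMap.monotone_of_nonneg (hg _) (hST _ (hx _))
    have key := sum_sq_sub_mul_div_eq _ _ hs hst
    have hsum : ∀ R : E →L[ℝ] E, ∑ p : Bool × Bool, g p.2 (R (x p.1)) = f j (R (a i)) := by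
      intro R
      simp [Fintype.sum_prod_type, g, x]
    rw [hsum S, hsum T] at key
    have hle := Finset.single_le_sum (f := fun p : Bool × Bool =>
      (g p.2 (S (x p.1)) - f j (S (a i)) / f j (T (a i)) * g p.2 (T (x p.1))) ^ 2
        / g p.2 (T (x p.1)))
      (fun p _ => div_nonneg (sq_nonneg _) ((hs p).trans (hst p)))
      (Finset.mem_univ (true, true))
    rw [key] at hle
    simpa only [Fintype.sum_prod_type, Fintype.sum_bool, g, x, if_true, Bool.false_eq_true,
      if_false] using hle
  refine (Finset.sum_le_sum fun i _ => Finset.sum_le_sum fun j _ => hcell i j).trans_eq ?_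
  simp only [relativeEnergy, Fintype.sum_prod_type, Fintype.sum_bool, if_true,
    Bool.false_eq_true, if_false, Finset.sum_sub_distrib, Finset.sum_add_distrib]
  rw [add_add_add_comm]

/-- Up to `ε`, an operator `0 ≤ S ≤ T` acts on `[0, u] × [0, ψ]` as a combination of finitely many
blocks of `T`. -/
theorem exists_block_approximation (hS : ∀ x, 0 ≤ x → 0 ≤ S x) (hST : ∀ x, 0 ≤ x → S x ≤ T x)
    {u : E} (hu : 0 ≤ u) {ψ : E →ₗ[ℝ] ℝ} (hψ : ∀ x, 0 ≤ x → 0 ≤ ψ x) {ε : ℝ} (hε : 0 < ε) :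
    ∃ (I J : Type) (_ : Fintype I) (_ : Fintype J) (a : I → E) (f : J → E →ₗ[ℝ] ℝ)
      (h : I → J → ℝ), (∀ i, 0 ≤ a i) ∧ ∑ i, a i = u ∧ (∀ j x, 0 ≤ x → 0 ≤ f j x) ∧
      (∀ x, ∑ j, f j x = ψ x) ∧
      ∀ (b : I → E) (k : J → E →ₗ[ℝ] ℝ), (∀ i, 0 ≤ b i ∧ b i ≤ a i) →
        (∀ j x, 0 ≤ x → 0 ≤ k j x ∧ k j x ≤ f j x) →
        |∑ i, ∑ j, (k j (S (b i)) - h i j * k j (T (b i)))| ≤ ε := by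
  let energies : Set ℝ := {e | ∃ (I J : Type) (_ : Fintype I) (_ : Fintype J) (a : I → E)
    (f : J → E →ₗ[ℝ] ℝ), ((∀ i, 0 ≤ a i) ∧ ∑ i, a i = u ∧ (∀ j x, 0 ≤ x → 0 ≤ f j x) ∧
      ∀ x, ∑ j, f j x = ψ x) ∧ relativeEnergy S T a f = e}
  have htotal : ∀ {I J : Type} [Fintype I] [Fintype J] {a : I → E} {f : J → E →ₗ[ℝ] ℝ},
      ∑ i, a i = u → (∀ x, ∑ j, f j x = ψ x) → ∑ i, ∑ j, f j (T (a i)) = ψ (T u) := by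
    intro I J _ _ a f hau hfψ
    simp only [hfψ]
    rw [← map_sum, ← map_sum, hau]
  have hbdd : BddAbove energies := by
    refine ⟨ψ (T u), ?_⟩
    rintro _ ⟨I, J, _, _, a, f, ⟨ha, hau, hf, hfψ⟩, rfl⟩
    exact (relativeEnergy_le hS hST ha hf).trans_eq (htotal hau hfψ)
  have hne : energies.Nonempty :=
    ⟨_, Unit, Unit, inferInstance, inferInstance, fun _ => u, fun _ => ψ,
      ⟨fun _ => hu, by simp, fun _ => hψ, by simp⟩, rfl⟩
  have hM : 0 ≤ ψ (T u) := hψ _ ((hS u hu).trans (hST u hu))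
  obtain ⟨_, ⟨I, J, _, _, a, f, ⟨ha, hau, hf, hfψ⟩, rfl⟩, hlt⟩ :=
    exists_lt_of_lt_csSup hne (sub_lt_self (sSup energies)
      (show 0 < ε ^ 2 / (ψ (T u) + 1) by positivity))
  refine ⟨I, J, inferInstance, inferInstance, a, f,
    fun i j => f j (S (a i)) / f j (T (a i)), ha, hau, hf, hfψ, fun b k hb hk => ?_⟩
  have hT : ∀ x, 0 ≤ x → 0 ≤ T x := fun x hx => (hS x hx).trans (hST x hx)
  have hmem : relativeEnergy S T (fun p : I × Bool => if p.2 then b p.1 else a p.1 - b p.1)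
      (fun q : J × Bool => if q.2 then k q.1 else f q.1 - k q.1) ∈ energies := by
    refine ⟨_, _, _, _, _, _, ⟨?_, ?_, ?_, ?_⟩, rfl⟩
    · rintro ⟨i, _ | _⟩
      · simpa using (hb i).2
      · simpa using (hb i).1
    · simpa [Fintype.sum_prod_type] using hau
    · rintro ⟨j, _ | _⟩ x hx
      · simpa using (hk j x hx).2
      · simpa using (hk j x hx).1
    · intro x
      simpa [Fintype.sum_prod_type] using hfψ x
  have hdefect := (sum_defect_le_relativeEnergy_sub hS hST hb hk).trans
    (sub_le_sub_right (le_csSup hbdd hmem) _)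
  have hweight : ∑ i, ∑ j, k j (T (b i)) ≤ ψ (T u) := by
    rw [← htotal hau hfψ]
    refine Finset.sum_le_sum fun i _ => Finset.sum_le_sum fun j _ => ?_
    exact ((hk j _ (hT _ (hb i).1)).2).trans (LinearMap.monotone_of_nonneg (hf j)
      (LinearMap.monotone_of_nonneg (f := (T : E →ₗ[ℝ] E)) hT (hb i).2))
  rw [← Fintype.sum_prod_type'] at hdefect hweight ⊢
  refine abs_le_of_sq_le_sq ?_ hε.le
  have hcs := Finset.sum_sq_le_sum_mul_sum_of_sq_le_mul Finset.univ
    (r := fun p : I × J => k p.2 (S (b p.1))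
      - f p.2 (S (a p.1)) / f p.2 (T (a p.1)) * k p.2 (T (b p.1)))
    (f := fun p : I × J => (k p.2 (S (b p.1))
      - f p.2 (S (a p.1)) / f p.2 (T (a p.1)) * k p.2 (T (b p.1))) ^ 2 / k p.2 (T (b p.1)))
    (g := fun p : I × J => k p.2 (T (b p.1)))
    (fun p _ => div_nonneg (sq_nonneg _) (hk _ _ (hT _ (hb _).1)).1)
    (fun p _ => (hk _ _ (hT _ (hb _).1)).1)
    (fun p _ => by
      rcases eq_or_ne (k p.2 (T (b p.1))) 0 with h | h
      · have h0 := (hk p.2 _ (hS _ (hb p.1).1)).1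
        have h1 := LinearMap.monotone_of_nonneg (fun x hx => (hk p.2 x hx).1)
          (hST _ (hb p.1).1)
        have : k p.2 (S (b p.1)) = 0 := le_antisymm (h ▸ h1) h0
        simp [h, this]
      · rw [div_mul_cancel₀ _ h])
  refine hcs.trans ((mul_le_mul (hdefect.trans (by linarith : _ ≤ ε ^ 2 / (ψ (T u) + 1))) hweight
    (Finset.sum_nonneg fun p _ => (hk _ _ (hT _ (hb _).1)).1) (by positivity)).trans ?_)
  rw [div_mul_eq_mul_div]
  exact div_le_of_le_mul₀ (by positivity) (by positivity) (by nlinarith [sq_nonneg ε])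

end Energy

section BanachLattice

variable {E : Type*} [NormedAddCommGroup E] [Lattice E] [HasSolidNorm E]
  [IsOrderedAddMonoid E] [NormedSpace ℝ E]

theorem isOrderedModule_real_of_hasSolidNorm : IsOrderedModule ℝ E := by
  refine IsOrderedModule.of_smul_nonneg fun a ha b hb => ?_
  have half : ∀ c : E, 0 ≤ c → 0 ≤ (2⁻¹ : ℝ) • c := by
    intro c hc
    have h2 : 0 ≤ 2 • ((2⁻¹ : ℝ) • c) := by
      rw [← Nat.cast_smul_eq_nsmul ℝ, smul_smul]
      simpa using hc
    exact nsmul_two_semiclosed h2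
  have dyadic : ∀ (n : ℕ), 0 ≤ (((2 : ℝ) ^ n)⁻¹) • b := by
    intro n
    induction n with
    | zero => simpa using hb
    | succ n ih =>
      have := half _ ih
      rw [smul_smul] at this
      rwa [pow_succ, mul_inv, mul_comm]
  have hlim : Filter.Tendsto (fun n : ℕ => ((⌊a * (2 : ℝ) ^ n⌋₊ : ℝ) / (2 : ℝ) ^ n) • b)
      Filter.atTop (nhds (a • b)) :=
    ((tendsto_nat_floor_mul_div_atTop ha).comp
      (tendsto_pow_atTop_atTop_of_one_lt one_lt_two)).smul_const b
  refine ge_of_tendsto' hlim fun n => ?_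
  rw [div_eq_mul_inv, mul_smul, Nat.cast_smul_eq_nsmul]
  exact nsmul_nonneg (dyadic n) _

theorem posPart_smul_of_pos {c : ℝ} (hc : 0 < c) (x : E) : (c • x)⁺ = c • x⁺ := by
  have := isOrderedModule_real_of_hasSolidNorm (E := E)
  have := (OrderIso.smulRight (β := E) hc).map_sup x 0
  rw [OrderIso.smulRight_apply, OrderIso.smulRight_apply, OrderIso.smulRight_apply,
    smul_zero] at this
  exact this.symm

theorem exists_nonneg_functional_eq_norm {z : E} (hz : 0 ≤ z) :
    ∃ g : E →ₗ[ℝ] ℝ, (∀ x, 0 ≤ x → 0 ≤ g x) ∧ (∀ x, 0 ≤ x → g x ≤ ‖x‖) ∧ g z = ‖z‖ := by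
  obtain ⟨g, hg, hgp⟩ := exists_le_sublinear_eq (fun x : E => ‖x⁺‖)
    (fun c hc x => by
      simp only [posPart_smul_of_pos hc, norm_smul, Real.norm_of_nonneg hc.le])
    (fun x y => (norm_le_norm_of_nonneg_of_le (posPart_nonneg _)
      (posPart_add_le_add_posPart x y)).trans (norm_add_le _ _)) z
  refine ⟨g, fun x hx => ?_, fun x hx => ?_, ?_⟩
  · have := hgp (-x)
    rw [posPart_of_nonpos (neg_nonpos.2 hx), norm_zero, map_neg] at this
    linarith
  · simpa [posPart_of_nonneg hx] using hgp x
  · simpa [posPart_of_nonneg hz] using hg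

theorem exists_functional_le_eq_apply_posPart {ψ : E →ₗ[ℝ] ℝ} (hψ : ∀ x, 0 ≤ x → 0 ≤ ψ x)
    (y : E) :
    ∃ g : E →ₗ[ℝ] ℝ, (∀ x, 0 ≤ x → 0 ≤ g x ∧ g x ≤ ψ x) ∧ g y = ψ y⁺ := by
  obtain ⟨g, hg, hgp⟩ := exists_le_sublinear_eq (fun x : E => ψ x⁺)
    (fun c hc x => by simp [posPart_smul_of_pos hc])
    (fun x y => by
      rw [← map_add]
      exact LinearMap.monotone_of_nonneg hψ (posPart_add_le_add_posPart x y)) y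
  refine ⟨g, fun x hx => ⟨?_, ?_⟩, hg⟩
  · have := hgp (-x)
    rw [posPart_of_nonpos (neg_nonpos.2 hx), map_zero, map_neg] at this
    linarith
  · simpa [posPart_of_nonneg hx] using hgp x

theorem exists_functional_decomposition {J : Type*} [Fintype J] {f : J → E →ₗ[ℝ] ℝ}
    (hf : ∀ j x, 0 ≤ x → 0 ≤ f j x) {g : E →ₗ[ℝ] ℝ}
    (hg : ∀ x, 0 ≤ x → 0 ≤ g x ∧ g x ≤ ∑ j, f j x) :
    ∃ k : J → E →ₗ[ℝ] ℝ, (∀ j x, 0 ≤ x → 0 ≤ k j x ∧ k j x ≤ f j x) ∧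
      ∀ x, ∑ j, k j x = g x := by
  classical
  obtain ⟨G, hG, hGp⟩ := exists_comp_eq_of_le_sublinear
    (LinearMap.pi fun _ : J => (LinearMap.id : E →ₗ[ℝ] E)) g
    (fun y : J → E => ∑ j, f j (y j)⁺)
    (fun c hc x => by simp [posPart_smul_of_pos hc, Finset.mul_sum])
    (fun x y => by
      rw [← Finset.sum_add_distrib]
      refine Finset.sum_le_sum fun j _ => ?_
      rw [← map_add]
      exact LinearMap.monotone_of_nonneg (hf j) (posPart_add_le_add_posPart _ _))
    (fun x => (LinearMap.monotone_of_nonneg (fun x hx => (hg x hx).1) (le_posPart x)).trans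
      (hg _ (posPart_nonneg x)).2)
  have hsingle : ∀ j x, G (Pi.single j x) ≤ f j x⁺ := by
    intro j x
    refine (hGp _).trans_eq ?_
    rw [Finset.sum_eq_single j]
    · simp
    · intro i _ hij
      simp [Pi.single_eq_of_ne hij]
    · simp
  refine ⟨fun j => G ∘ₗ LinearMap.single ℝ (fun _ => E) j, fun j x hx => ⟨?_, ?_⟩, fun x => ?_⟩
  · have := hsingle j (-x)
    rw [posPart_of_nonpos (neg_nonpos.2 hx), map_zero, Pi.single_neg, map_neg] at this
    simpa using this
  · simpa [posPart_of_nonneg hx] using hsingle j x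
  · rw [← hG x]
    simp only [LinearMap.comp_apply, LinearMap.coe_single, ← map_sum]
    rw [Finset.univ_sum_single (fun _ => x)]
    rfl

variable {S T : E →L[ℝ] E}

/-- An operator dominated by a compact one maps `[0, u]` to a set which is totally bounded for
the seminorm `ψ |·|`. -/
theorem exists_finite_net_of_le_compact (hS : ∀ x, 0 ≤ x → 0 ≤ S x)
    (hST : ∀ x, 0 ≤ x → S x ≤ T x) (hT : IsCompactOperator T) {u : E} (hu : 0 ≤ u)
    {ψ : E →ₗ[ℝ] ℝ} (hψ : ∀ x, 0 ≤ x → 0 ≤ ψ x) {C : ℝ} (hC : 0 ≤ C)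
    (hψC : ∀ x, 0 ≤ x → ψ x ≤ C * ‖x‖) {ε : ℝ} (hε : 0 < ε) :
    ∃ F : Set E, F.Finite ∧ F ⊆ Set.Icc 0 u ∧
      ∀ x ∈ Set.Icc 0 u, ∃ y ∈ F, ψ |S x - S y| ≤ ε := by
  obtain ⟨I, J, _, _, a, f, h, ha, hau, hf, hfψ, happ⟩ :=
    exists_block_approximation hS hST hu hψ (show 0 < ε / 6 by positivity)
  have hdec : ∀ x : Set.Icc (0 : E) u, ∃ b : I → E, (∀ i, 0 ≤ b i ∧ b i ≤ a i) ∧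
      ∑ i, b i = (x : E) := fun x =>
    exists_riesz_decomposition Finset.univ ha x.2.1 (by rw [hau]; exact x.2.2)
  choose b hb hbx using hdec
  have hau' : ∀ i, a i ≤ u := fun i =>
    hau ▸ Finset.single_le_sum (fun i _ => ha i) (Finset.mem_univ i)
  let Φ : Set.Icc (0 : E) u → I → E := fun x i => T (b x i)
  have htb : TotallyBounded (Set.range Φ) := by
    refine (isCompact_univ_pi fun _ : I =>
      hT.isCompact_closure_image_closedBall ‖u‖).totallyBounded.subset ?_
    rintro _ ⟨x, rfl⟩ i -
    refine subset_closure ⟨b x i, ?_, rfl⟩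
    rw [mem_closedBall_zero_iff]
    exact norm_le_norm_of_nonneg_of_le (hb x i).1 ((hb x i).2.trans (hau' i))
  set H : ℝ := ∑ i, ∑ j, |h i j| with hH
  have hH0 : 0 ≤ H := Finset.sum_nonneg fun i _ => Finset.sum_nonneg fun j _ => abs_nonneg _
  obtain ⟨t, htsub, htfin, htcov⟩ := Metric.finite_approx_of_totallyBounded htb
    (ε / 6 / (H * C + 1)) (by positivity)
  have hlift : ∀ y : t, ∃ x, Φ x = y := fun y => htsub y.2
  choose r hr using hlift
  have := htfin.to_subtype
  refine ⟨Set.range fun y => (r y : E), Set.finite_range _, ?_, fun x hx => ?_⟩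
  · rintro _ ⟨y, rfl⟩
    exact (r y).2
  obtain ⟨z, hz, hxz⟩ := Set.mem_iUnion₂.1 (htcov ⟨⟨x, hx⟩, rfl⟩)
  refine ⟨_, ⟨⟨z, hz⟩, rfl⟩, ?_⟩
  set x₁ : Set.Icc (0 : E) u := ⟨x, hx⟩
  set x₂ := r ⟨z, hz⟩ with hx₂
  have hclose : ∀ i, ‖T (b x₁ i) - T (b x₂ i)‖ ≤ ε / 6 / (H * C + 1) := by
    intro i
    rw [← dist_eq_norm]
    refine (dist_le_pi_dist (Φ x₁) (Φ x₂) i).trans ?_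
    rw [hx₂, hr]
    exact (Metric.mem_ball.1 hxz).le
  have hfun : ∀ g : E →ₗ[ℝ] ℝ, (∀ y, 0 ≤ y → 0 ≤ g y ∧ g y ≤ ψ y) →
      |g (S x₁ - S x₂)| ≤ ε / 2 := by
    intro g hg
    obtain ⟨k, hk, hkg⟩ := exists_functional_decomposition hf (g := g) (fun y hy => by
      rw [hfψ]
      exact hg y hy)
    have hgS : ∀ x : Set.Icc (0 : E) u, g (S (x : E)) = ∑ i, ∑ j, k j (S (b x i)) := by
      intro x
      simp only [hkg]
      rw [← map_sum, ← map_sum, hbx]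
    have hkT : ∀ i j, |k j (T (b x₁ i) - T (b x₂ i))| ≤ C * (ε / 6 / (H * C + 1)) := by
      intro i j
      set y := T (b x₁ i) - T (b x₂ i)
      calc |k j y| ≤ k j |y| := LinearMap.abs_apply_le_of_nonneg (fun x hx => (hk j x hx).1) y
        _ ≤ ∑ j, k j |y| := Finset.single_le_sum
            (fun j _ => (hk j _ (abs_nonneg y)).1) (Finset.mem_univ j)
        _ ≤ ψ |y| := (hkg _).trans_le (hg _ (abs_nonneg y)).2
        _ ≤ C * ‖y‖ := by simpa [norm_abs_eq_norm] using hψC _ (abs_nonneg y)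
        _ ≤ _ := mul_le_mul_of_nonneg_left (hclose i) hC
    have hmid : |∑ i, ∑ j, h i j * k j (T (b x₁ i) - T (b x₂ i))| ≤ ε / 6 := by
      calc _ ≤ ∑ i, ∑ j, |h i j| * (C * (ε / 6 / (H * C + 1))) := by
            refine (Finset.abs_sum_le_sum_abs _ _).trans (Finset.sum_le_sum fun i _ => ?_)
            refine (Finset.abs_sum_le_sum_abs _ _).trans (Finset.sum_le_sum fun j _ => ?_)
            rw [abs_mul]
            exact mul_le_mul_of_nonneg_left (hkT i j) (abs_nonneg _)
        _ = (H * C) * (ε / 6) / (H * C + 1) := by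
            simp only [← Finset.sum_mul, ← hH]
            ring
        _ ≤ ε / 6 := div_le_of_le_mul₀ (by positivity) (by positivity) (by nlinarith)
    have h1 := abs_le.1 (happ (b x₁) k (hb x₁) hk)
    have h2 := abs_le.1 (happ (b x₂) k (hb x₂) hk)
    have h3 := abs_le.1 hmid
    simp only [Finset.sum_sub_distrib, map_sub, mul_sub] at h1 h2 h3
    rw [map_sub, hgS, hgS]
    exact abs_le.2 ⟨by linarith, by linarith⟩
  have habs : ∀ y : E, ψ |y| = ψ y⁺ + ψ (-y)⁺ := by
    intro y
    rw [← map_add, posPart_neg, posPart_add_negPart]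
  rw [habs]
  obtain ⟨g, hg, hgy⟩ := exists_functional_le_eq_apply_posPart hψ (S x₁ - S x₂)
  obtain ⟨g', hg', hgy'⟩ := exists_functional_le_eq_apply_posPart hψ (-(S x₁ - S x₂))
  have h1 := (le_abs_self _).trans (hfun g hg)
  have h2 := (neg_le_abs _).trans (hfun g' hg')
  rw [map_neg] at hgy'
  linarith

/-- A compact operator is controlled on bounded positive vectors by a positive functional. -/
theorem IsCompactOperator.exists_norm_apply_le_functional_add (hpos : ∀ x, 0 ≤ x → 0 ≤ T x)
    (hT : IsCompactOperator T) (R : ℝ) {ε : ℝ} (hε : 0 < ε) :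
    ∃ (ψ : E →ₗ[ℝ] ℝ) (C : ℝ), 0 ≤ C ∧ (∀ x, 0 ≤ x → 0 ≤ ψ x) ∧
      (∀ x, 0 ≤ x → ψ x ≤ C * ‖x‖) ∧ ∀ x, 0 ≤ x → ‖x‖ ≤ R → ‖T x‖ ≤ ψ x + ε := by
  have htb : TotallyBounded (T '' {x | 0 ≤ x ∧ ‖x‖ ≤ R}) :=
    (hT.isCompact_closure_image_closedBall R).totallyBounded.subset
      ((Set.image_mono fun x hx => mem_closedBall_zero_iff.2 hx.2).trans subset_closure)
  obtain ⟨t, htsub, htfin, htcov⟩ := Metric.finite_approx_of_totallyBounded htb (ε / 2)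
    (by positivity)
  have := htfin.fintype
  have ht0 : ∀ z : t, (0 : E) ≤ z := by
    rintro ⟨z, hz⟩
    obtain ⟨x, hx, rfl⟩ := htsub hz
    exact hpos x hx.1
  choose g hg0 hgle hgz using fun z : t => exists_nonneg_functional_eq_norm (ht0 z)
  have hψ : ∀ x, (∑ z, g z ∘ₗ (T : E →ₗ[ℝ] E)) x = ∑ z, g z (T x) := fun x => by simp
  refine ⟨∑ z, g z ∘ₗ (T : E →ₗ[ℝ] E), Fintype.card t * ‖T‖, by positivity, fun x hx => ?_,
    fun x hx => ?_, fun x hx hxR => ?_⟩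
  · rw [hψ]
    exact Finset.sum_nonneg fun z _ => hg0 z _ (hpos x hx)
  · rw [hψ]
    refine (Finset.sum_le_card_nsmul _ _ (‖T‖ * ‖x‖) fun z _ =>
      (hgle z _ (hpos x hx)).trans (T.le_opNorm x)).trans_eq ?_
    rw [nsmul_eq_mul, mul_assoc]
    rfl
  · obtain ⟨z, hz, hxz⟩ := Set.mem_iUnion₂.1 (htcov ⟨x, ⟨hx, hxR⟩, rfl⟩)
    rw [Metric.mem_ball, dist_eq_norm] at hxz
    let w : t := ⟨z, hz⟩
    have h1 : g w (T x) ≤ ∑ z, g z (T x) := Finset.single_le_sum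
      (f := fun z => g z (T x)) (fun z _ => hg0 z _ (hpos x hx)) (Finset.mem_univ w)
    have h2 : g w z = ‖z‖ := hgz w
    have h3 : g w (z - T x) ≤ ‖T x - z‖ := by
      refine (LinearMap.monotone_of_nonneg (hg0 w) (le_abs_self _)).trans ?_
      refine (hgle w _ (abs_nonneg _)).trans_eq ?_
      rw [norm_abs_eq_norm, norm_sub_rev]
    have h4 : ‖T x‖ ≤ ‖z‖ + ‖T x - z‖ := by
      simpa using norm_add_le z (T x - z)
    rw [map_sub] at h3
    rw [hψ]
    linarith

/-- A compact positive operator maps bounded positive sets into an order interval up to `ε`. -/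
theorem IsCompactOperator.exists_norm_posPart_apply_sub_le (hpos : ∀ x, 0 ≤ x → 0 ≤ T x)
    (hT : IsCompactOperator T) (R : ℝ) {ε : ℝ} (hε : 0 < ε) :
    ∃ v : E, 0 ≤ v ∧ ∀ x, 0 ≤ x → ‖x‖ ≤ R → ‖(T x - v)⁺‖ ≤ ε := by
  have htb : TotallyBounded (T '' {x | 0 ≤ x ∧ ‖x‖ ≤ R}) :=
    (hT.isCompact_closure_image_closedBall R).totallyBounded.subset
      ((Set.image_mono fun x hx => mem_closedBall_zero_iff.2 hx.2).trans subset_closure)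
  obtain ⟨t, htsub, htfin, htcov⟩ := Metric.finite_approx_of_totallyBounded htb ε hε
  have ht0 : ∀ z ∈ htfin.toFinset, 0 ≤ z := by
    intro z hz
    obtain ⟨x, hx, rfl⟩ := htsub (htfin.mem_toFinset.1 hz)
    exact hpos x hx.1
  refine ⟨∑ z ∈ htfin.toFinset, z, Finset.sum_nonneg ht0, fun x hx hxR => ?_⟩
  obtain ⟨z, hz, hxz⟩ := Set.mem_iUnion₂.1 (htcov ⟨x, ⟨hx, hxR⟩, rfl⟩)
  rw [Metric.mem_ball, dist_eq_norm] at hxz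
  have hzv : z ≤ ∑ z ∈ htfin.toFinset, z :=
    Finset.single_le_sum (f := id) ht0 (htfin.mem_toFinset.2 hz)
  refine le_trans ?_ hxz.le
  rw [← norm_abs_eq_norm (T x - z)]
  refine norm_le_norm_of_nonneg_of_le (posPart_nonneg _) (sup_le ?_ (abs_nonneg _))
  exact (sub_le_sub_left hzv _).trans (le_abs_self _)

theorem totallyBounded_sq_image_Icc (hS : ∀ x, 0 ≤ x → 0 ≤ S x)
    (hST : ∀ x, 0 ≤ x → S x ≤ T x) (hT : IsCompactOperator T) {u : E} (hu : 0 ≤ u) :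
    TotallyBounded ((fun x => S (S x)) '' Set.Icc 0 u) := by
  rw [Metric.totallyBounded_iff]
  intro ε hε
  have hTpos : ∀ x, 0 ≤ x → 0 ≤ T x := fun x hx => (hS x hx).trans (hST x hx)
  obtain ⟨ψ, C, hC, hψ, hψC, hbound⟩ := hT.exists_norm_apply_le_functional_add hTpos
    (‖S‖ * ‖u‖) (show 0 < ε / 3 by positivity)
  obtain ⟨F, hF, hFsub, hnet⟩ := exists_finite_net_of_le_compact hS hST hT hu hψ hC hψC
    (show 0 < ε / 3 by positivity)
  refine ⟨(fun x => S (S x)) '' F, hF.image _, ?_⟩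
  rintro _ ⟨x, hx, rfl⟩
  obtain ⟨y, hy, hxy⟩ := hnet x hx
  refine Set.mem_iUnion₂.2 ⟨_, ⟨y, hy, rfl⟩, ?_⟩
  have hSmono := LinearMap.monotone_of_nonneg (f := (S : E →ₗ[ℝ] E)) hS
  have hdiff : ‖|S x - S y|‖ ≤ ‖S‖ * ‖u‖ := by
    rw [norm_abs_eq_norm, ← map_sub]
    refine (S.le_opNorm _).trans (mul_le_mul_of_nonneg_left ?_ (norm_nonneg _))
    rw [← norm_abs_eq_norm]
    refine norm_le_norm_of_nonneg_of_le (abs_nonneg _) (abs_le'.2 ⟨?_, ?_⟩)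
    · exact (sub_le_self _ (hFsub hy).1).trans hx.2
    · rw [neg_sub]
      exact (sub_le_self _ hx.1).trans (hFsub hy).2
  have hle : ‖S (S x - S y)‖ ≤ ‖T |S x - S y|‖ := by
    rw [← norm_abs_eq_norm]
    refine norm_le_norm_of_nonneg_of_le (abs_nonneg _) (le_trans ?_ (hST _ (abs_nonneg _)))
    refine abs_le'.2 ⟨hSmono (le_abs_self _), ?_⟩
    rw [← map_neg]
    exact hSmono (neg_le_abs _)
  rw [Metric.mem_ball, dist_eq_norm, ← map_sub]
  have := hbound _ (abs_nonneg _) hdiff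
  linarith

/-- **Aliprantis–Burkinshaw**: the cube of a positive operator dominated by a compact operator
is compact. -/
theorem IsCompactOperator.pow_three_of_le [CompleteSpace E] (hS : ∀ x, 0 ≤ x → 0 ≤ S x)
    (hST : ∀ x, 0 ≤ x → S x ≤ T x) (hT : IsCompactOperator T) :
    IsCompactOperator ⇑(S ^ 3) := by
  have hTpos : ∀ x, 0 ≤ x → 0 ≤ T x := fun x hx => (hS x hx).trans (hST x hx)
  have hpow : ∀ x, (S ^ 3) x = S (S (S x)) := fun x => by simp [pow_succ]
  have hpos : TotallyBounded (⇑(S ^ 3) '' {x | 0 ≤ x ∧ ‖x‖ ≤ 1}) := by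
    rw [Metric.totallyBounded_iff]
    intro ε hε
    set M := ‖S‖ * ‖S‖ with hM
    have hM0 : 0 ≤ M := by positivity
    obtain ⟨v, hv, hxv⟩ := hT.exists_norm_posPart_apply_sub_le hTpos 1
      (show 0 < ε / 2 / (M + 1) by positivity)
    obtain ⟨t, ht, htcov⟩ := Metric.totallyBounded_iff.1
      (totallyBounded_sq_image_Icc hS hST hT hv) (ε / 2) (by positivity)
    refine ⟨t, ht, ?_⟩
    rintro _ ⟨x, ⟨hx, hx1⟩, rfl⟩
    obtain ⟨z, hz, hxz⟩ := Set.mem_iUnion₂.1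
      (htcov ⟨S x ⊓ v, ⟨le_inf (hS x hx) hv, inf_le_right⟩, rfl⟩)
    refine Set.mem_iUnion₂.2 ⟨z, hz, ?_⟩
    rw [Metric.mem_ball] at hxz ⊢
    have hsplit : S x - S x ⊓ v = (S x - v)⁺ := by
      rw [posPart_def, sub_inf, sub_self, sup_comm]
    have hnorm : ‖(S x - v)⁺‖ ≤ ε / 2 / (M + 1) :=
      (norm_le_norm_of_nonneg_of_le (posPart_nonneg _)
        (posPart_mono (sub_le_sub_right (hST x hx) v))).trans (hxv x hx hx1)
    have hfar : dist ((S ^ 3) x) (S (S (S x ⊓ v))) ≤ ε / 2 := by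
      rw [hpow, dist_eq_norm, ← map_sub, ← map_sub, hsplit]
      calc _ ≤ ‖S‖ * (‖S‖ * ‖(S x - v)⁺‖) := (S.le_opNorm _).trans
            (mul_le_mul_of_nonneg_left (S.le_opNorm _) (norm_nonneg _))
        _ = M * ‖(S x - v)⁺‖ := by rw [hM, mul_assoc]
        _ ≤ M * (ε / 2 / (M + 1)) := mul_le_mul_of_nonneg_left hnorm hM0
        _ = M * (ε / 2) / (M + 1) := by ring
        _ ≤ ε / 2 := div_le_of_le_mul₀ (by positivity) (by positivity) (by nlinarith)
    linarith [dist_triangle ((S ^ 3) x) (S (S (S x ⊓ v))) z]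
  have hcpt := hpos.closure.isCompact_of_isClosed isClosed_closure
  refine ⟨_, (hcpt.prod hcpt).image continuous_sub, Filter.mem_of_superset (Metric.closedBall_mem_nhds 0 one_pos) ?_⟩
  intro x hx
  rw [mem_closedBall_zero_iff] at hx
  have hp : ‖x⁺‖ ≤ 1 := by
    refine le_trans ?_ hx
    rw [← norm_abs_eq_norm x]
    exact norm_le_norm_of_nonneg_of_le (posPart_nonneg _) (sup_le (le_abs_self _) (abs_nonneg _))
  have hn : ‖x⁻‖ ≤ 1 := by
    refine le_trans ?_ hx
    rw [← norm_abs_eq_norm x]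
    exact norm_le_norm_of_nonneg_of_le (negPart_nonneg _) (sup_le (neg_le_abs _) (abs_nonneg _))
  refine ⟨((S ^ 3) x⁺, (S ^ 3) x⁻), ⟨subset_closure ⟨_, ⟨posPart_nonneg _, hp⟩, rfl⟩,
    subset_closure ⟨_, ⟨negPart_nonneg _, hn⟩, rfl⟩⟩, ?_⟩
  change (S ^ 3) x⁺ - (S ^ 3) x⁻ = (S ^ 3) x
  rw [← map_sub, posPart_sub_negPart]

end BanachLattice

section PositiveCommutator

variable {E : Type*} [NormedAddCommGroup E] [Lattice E] [NormedSpace ℝ E] {A B : E →L[ℝ] E}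

theorem ContinuousLinearMap.pow_apply_nonneg (hA : ∀ x : E, 0 ≤ x → 0 ≤ A x) (n : ℕ) :
    ∀ x : E, 0 ≤ x → 0 ≤ (A ^ n) x := by
  induction n with
  | zero => exact fun x hx => by simpa using hx
  | succ n ih =>
    intro x hx
    rw [pow_succ']
    exact hA _ (ih x hx)

variable [IsOrderedAddMonoid E]

theorem mul_pow_apply_le_pow_mul_apply (hA : ∀ x : E, 0 ≤ x → 0 ≤ A x)
    (hC : ∀ x : E, 0 ≤ x → 0 ≤ (A * B - B * A) x) (n : ℕ) :
    ∀ x : E, 0 ≤ x → B ((A ^ n) x) ≤ (A ^ n) (B x) := by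
  have hAmono := LinearMap.monotone_of_nonneg (f := (A : E →ₗ[ℝ] E)) hA
  induction n with
  | zero => exact fun x _ => by simp
  | succ n ih =>
    intro x hx
    rw [pow_succ']
    have h := hC _ (ContinuousLinearMap.pow_apply_nonneg hA n x hx)
    exact (sub_nonneg.1 h).trans (hAmono (ih x hx))

theorem pow_mul_apply_le_pow_mul_pow_apply (hA : ∀ x : E, 0 ≤ x → 0 ≤ A x)
    (hB : ∀ x : E, 0 ≤ x → 0 ≤ B x) (hC : ∀ x : E, 0 ≤ x → 0 ≤ (A * B - B * A) x) (n : ℕ) :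
    ∀ x : E, 0 ≤ x → ((A * B) ^ n) x ≤ (A ^ n * B ^ n) x := by
  have hAmono := LinearMap.monotone_of_nonneg (f := (A : E →ₗ[ℝ] E)) hA
  have hBmono := LinearMap.monotone_of_nonneg (f := (B : E →ₗ[ℝ] E)) hB
  induction n with
  | zero => exact fun x _ => by simp
  | succ n ih =>
    intro x hx
    rw [pow_succ', pow_succ' A, pow_succ' B]
    refine (hAmono (hBmono (ih x hx))).trans (hAmono ?_)
    exact mul_pow_apply_le_pow_mul_apply hA hC n _
      (ContinuousLinearMap.pow_apply_nonneg hB n x hx)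

end PositiveCommutator


/-- If `A` and `B` are positive operators on a Banach lattice `E` with positive
commutator `A B - B A`, and for some `n ≥ 1` one of `Aⁿ`, `Bⁿ` is compact, then `(A B)^{3n}`
is compact; in particular `A B` is power-compact. -/
theorem stmt8 {E : Type*} [NormedAddCommGroup E] [Lattice E] [HasSolidNorm E]
    [IsOrderedAddMonoid E] [NormedSpace ℝ E] [CompleteSpace E]
    (A B : E →L[ℝ] E)
    (hA : ∀ x : E, 0 ≤ x → 0 ≤ A x)
    (hB : ∀ x : E, 0 ≤ x → 0 ≤ B x)
    (hC : ∀ x : E, 0 ≤ x → 0 ≤ (A * B - B * A) x)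
    (n : ℕ) (hn : 1 ≤ n)
    (hc : IsCompactOperator ⇑(A ^ n) ∨ IsCompactOperator ⇑(B ^ n)) :
    IsCompactOperator ⇑((A * B) ^ (3 * n)) ∧
    ∃ m : ℕ, 1 ≤ m ∧ IsCompactOperator ⇑((A * B) ^ m) := by
  have hcompact : IsCompactOperator ⇑(A ^ n * B ^ n) :=
    hc.elim (fun h => h.comp_clm (B ^ n)) (fun h => h.clm_comp (A ^ n))
  have hcube : IsCompactOperator ⇑((A * B) ^ (3 * n)) := by
    rw [mul_comm, pow_mul]
    exact hcompact.pow_three_of_le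
      (ContinuousLinearMap.pow_apply_nonneg (A := A * B) (fun x hx => hA (B x) (hB x hx)) n)
      (pow_mul_apply_le_pow_mul_pow_apply hA hB hC n)
  exact ⟨hcube, 3 * n, by omega, hcube⟩
end
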